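/- Suppose ρ_crit > 0, let λ_low > 0 be such that ρ_max(λ) ≥ ρ_crit/4 for all λ ∈ [0, 2λ_low], and for δ ∈ (0,1) set α := 48(‖F‖∞ + 1/λ_low)(I_F + 2/λ_low) + (2‖F‖∞/λ_low)·√(2 log(2/δ)) and β := 96 I_F/λ_low + (4‖F‖∞/λ_low)·√(2 log(4/δ)). If α/√n < ρ ≤ ρ_crit/4 − β/√n, then the event { for all f ∈ F, R̂_ρ(f) ≥ R_{ρ − α/√n}(f) and R_{ρ − α/√n}(f) ≥ E_{ξ∼P}[f(ξ)] } has probability at least 1 − δ under the n-fold product measure P^{⊗n}. -/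

import Mathlib

open MeasureTheory Filter Set
open scoped ENNReal NNReal

noncomputable section

/-- The `t`-packing number of `F` for the uniform norm: the maximal cardinality of a
subset of `F` whose elements are pairwise at distance at least `t`. -/
def packingNum {Ξ : Type*} [TopologicalSpace Ξ] [CompactSpace Ξ]
    (F : Set C(Ξ, ℝ)) (t : ℝ) : ℝ≥0∞ :=
  ⨆ (s : Finset C(Ξ, ℝ)) (_ : ↑s ⊆ F ∧ (s : Set C(Ξ, ℝ)).Pairwise fun f g => t ≤ dist f g),
    (s.card : ℝ≥0∞)

/-- Dudley's entropy integral of `F`. -/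
def dudleyEntropy {Ξ : Type*} [TopologicalSpace Ξ] [CompactSpace Ξ] (F : Set C(Ξ, ℝ)) : ℝ :=
  ∫ t in Ioi (0 : ℝ), Real.sqrt (Real.log ((packingNum F t).toReal))

/-- `‖F‖∞ = sup_{f ∈ F} ‖f‖∞`. -/
def supNormF {Ξ : Type*} [TopologicalSpace Ξ] [CompactSpace Ξ] (F : Set C(Ξ, ℝ)) : ℝ :=
  ⨆ f : F, ‖(f : C(Ξ, ℝ))‖

/-- Optimal transport cost `W_c(Q, Q')`. -/
def transportCost {Ξ : Type*} [MeasurableSpace Ξ] (c : Ξ → Ξ → ℝ) (Q Q' : Measure Ξ) : ℝ :=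
  sInf { r | ∃ π : Measure (Ξ × Ξ), IsProbabilityMeasure π ∧
    π.map Prod.fst = Q ∧ π.map Prod.snd = Q' ∧ r = ∫ p, c p.1 p.2 ∂π }

/-- The Wasserstein robust risk `R_{ρ,Q}(f)`. -/
def robustRisk {Ξ : Type*} [MeasurableSpace Ξ] (c : Ξ → Ξ → ℝ) (ρ : ℝ)
    (Q : Measure Ξ) (f : Ξ → ℝ) : ℝ :=
  sSup { r | ∃ Q' : Measure Ξ, IsProbabilityMeasure Q' ∧ transportCost c Q Q' ≤ ρ ∧
    r = ∫ ξ, f ξ ∂Q' }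

/-- Empirical measure `P̂_n` of a sample `ω`. -/
def empiricalMeasure {Ξ : Type*} [MeasurableSpace Ξ] (n : ℕ) (ω : Fin n → Ξ) : Measure Ξ :=
  (n : ℝ≥0∞)⁻¹ • ∑ i : Fin n, Measure.dirac (ω i)

/-- Set of maximizers of `f` over `Ξ`. -/
def argmaxSet {Ξ : Type*} [TopologicalSpace Ξ] (f : C(Ξ, ℝ)) : Set Ξ := {ζ | ∀ ξ, f ξ ≤ f ζ}

/-- The critical radius `ρ_crit`. -/
def rhoCrit {Ξ : Type*} [TopologicalSpace Ξ] [MeasurableSpace Ξ]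
    (c : Ξ → Ξ → ℝ) (P : Measure Ξ) (F : Set C(Ξ, ℝ)) : ℝ :=
  ⨅ f : F, ∫ ξ, sInf (c ξ '' argmaxSet (f : C(Ξ, ℝ))) ∂P

/-- The maximal radius `ρ_max(λ)`. -/
def rhoMax {Ξ : Type*} [TopologicalSpace Ξ] [MeasurableSpace Ξ]
    (c : Ξ → Ξ → ℝ) (P : Measure Ξ) (F : Set C(Ξ, ℝ)) (lam : ℝ) : ℝ :=
  ⨅ f : F, ∫ ξ,
    sInf (c ξ '' {ζ | ∀ ζ', (f : C(Ξ, ℝ)) ζ' - lam * c ξ ζ' ≤ (f : C(Ξ, ℝ)) ζ - lam * c ξ ζ}) ∂P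

/-- The dual generator `φ(λ, f, ξ) = sup_ζ (f(ζ) - λ c(ξ, ζ))`. -/
def dualGen {Ξ : Type*} (c : Ξ → Ξ → ℝ) (lam : ℝ) (f : Ξ → ℝ) (ξ : Ξ) : ℝ :=
  ⨆ ζ, (f ζ - lam * c ξ ζ)

/-- `ψ(μ, f, ξ) = μ φ(μ⁻¹, f, ξ)`. -/
def psiGen {Ξ : Type*} (c : Ξ → Ξ → ℝ) (μ : ℝ) (f : Ξ → ℝ) (ξ : Ξ) : ℝ :=
  μ * dualGen c μ⁻¹ f ξ

/-- A bounded measurable real function is integrable for a finite measure. -/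
theorem integrable_of_abs_le {Ω : Type*} [MeasurableSpace Ω] {μ : Measure Ω} [IsFiniteMeasure μ]
    {f : Ω → ℝ} (hf : Measurable f) {C : ℝ} (hC : ∀ ω, |f ω| ≤ C) : Integrable f μ :=
  Integrable.of_bound hf.aestronglyMeasurable C (Eventually.of_forall hC)

theorem integrable_exp_of_abs_le {Ω : Type*} [MeasurableSpace Ω] {μ : Measure Ω}
    [IsFiniteMeasure μ] {f : Ω → ℝ} (hf : Measurable f) {C : ℝ} (hC : ∀ ω, |f ω| ≤ C) :
    Integrable (fun ω => Real.exp (f ω)) μ := by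
  refine integrable_of_abs_le (C := Real.exp C) (Real.measurable_exp.comp hf) fun ω => ?_
  rw [abs_of_pos (Real.exp_pos _)]
  exact Real.exp_le_exp.2 ((le_abs_self _).trans (hC ω))

/-- Hoeffding's lemma for a bounded function of oscillation at most `r`. -/
theorem integral_exp_sub_integral_le {Ξ : Type*} [MeasurableSpace Ξ] (P : Measure Ξ)
    [IsProbabilityMeasure P] {f : Ξ → ℝ} (hf : Measurable f) {r : ℝ}
    (hosc : ∀ x y, |f x - f y| ≤ r) (s : ℝ) :
    ∫ x, Real.exp (s * (f x - ∫ y, f y ∂P)) ∂P ≤ Real.exp (s ^ 2 * r ^ 2 / 8) := by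
  have : Nonempty Ξ := nonempty_of_isProbabilityMeasure P
  obtain ⟨x₀⟩ := this
  have hbdd : BddBelow (range f) := by
    refine ⟨f x₀ - r, ?_⟩
    rintro _ ⟨x, rfl⟩
    have := (abs_le.1 (hosc x₀ x)).2
    linarith
  have hmem : ∀ x, f x ∈ Icc (⨅ y, f y) ((⨅ y, f y) + r) := by
    intro x
    refine ⟨ciInf_le hbdd x, ?_⟩
    have : Nonempty Ξ := ⟨x₀⟩
    have : f x - r ≤ ⨅ y, f y := le_ciInf fun y => by
      have := (abs_le.1 (hosc x y)).2
      linarith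
    linarith
  have h := (ProbabilityTheory.hasSubgaussianMGF_of_mem_Icc (μ := P) hf.aemeasurable
    (Eventually.of_forall hmem)).mgf_le s
  refine h.trans (Real.exp_le_exp.2 (le_of_eq ?_))
  simp only [add_sub_cancel_left, NNReal.coe_pow, NNReal.coe_div, coe_nnnorm, Real.norm_eq_abs,
    NNReal.coe_ofNat, div_pow, sq_abs]
  ring

/-- Moment generating function form of McDiarmid's bounded differences inequality. -/
theorem integral_exp_sub_integral_le_of_bounded_differences {Ξ : Type*} [MeasurableSpace Ξ]
    (P : Measure Ξ) [IsProbabilityMeasure P] (n : ℕ) (f : (Fin n → Ξ) → ℝ) (hf : Measurable f)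
    (C r : ℝ) (hC : ∀ ω, |f ω| ≤ C)
    (hr : ∀ ω i x, |f (Function.update ω i x) - f ω| ≤ r) (s : ℝ) :
    ∫ ω, Real.exp (s * (f ω - ∫ ω', f ω' ∂Measure.pi fun _ : Fin n => P))
      ∂(Measure.pi fun _ : Fin n => P) ≤ Real.exp (s ^ 2 * (n * r ^ 2) / 8) := by
  induction n with
  | zero =>
    have h : ∀ ω, f ω = f default := fun ω => congrArg f (Subsingleton.elim _ _)
    simp [h]
  | succ n ih =>
    set Q := Measure.pi fun _ : Fin n => P with hQ
    have hmp := (measurePreserving_piFinSuccAbove (fun _ : Fin (n + 1) => P) 0).symm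
    have hint : ∀ g : (Fin (n + 1) → Ξ) → ℝ,
        ∫ ω, g ω ∂(Measure.pi fun _ : Fin (n + 1) => P)
          = ∫ p : Ξ × (Fin n → Ξ), g (Fin.cons p.1 p.2) ∂(P.prod Q) := by
      intro g
      rw [← hmp.integral_comp']
      simp only [MeasurableEquiv.piFinSuccAbove_symm_apply, Fin.insertNthEquiv,
        Fin.insertNth_zero, Equiv.coe_fn_mk]
      rfl
    have hcons : Measurable fun p : Ξ × (Fin n → Ξ) => (Fin.cons p.1 p.2 : Fin (n + 1) → Ξ) := by
      refine measurable_pi_lambda _ fun i => ?_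
      refine Fin.cases ?_ (fun j => ?_) i
      · simpa using measurable_fst
      · simpa [Function.comp_def] using (measurable_pi_apply j).comp measurable_snd
    have hfc : Measurable fun p : Ξ × (Fin n → Ξ) => f (Fin.cons p.1 p.2) := hf.comp hcons
    have hfω : ∀ ω, Measurable fun x => f (Fin.cons x ω) := fun ω =>
      hfc.comp (measurable_id.prodMk measurable_const)
    set g : (Fin n → Ξ) → ℝ := fun ω => ∫ x, f (Fin.cons x ω) ∂P with hg
    have hgm : Measurable g :=
      (hfc.stronglyMeasurable.integral_prod_left).measurable
    have hfint : Integrable (fun p : Ξ × (Fin n → Ξ) => f (Fin.cons p.1 p.2)) (P.prod Q) :=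
      integrable_of_abs_le hfc fun p => hC _
    have hfωint : ∀ ω, Integrable (fun x => f (Fin.cons x ω)) P := fun ω =>
      integrable_of_abs_le (hfω ω) fun p => hC _
    have habs : ∀ h : Ξ → ℝ, ∀ K, (∀ x, |h x| ≤ K) → |∫ x, h x ∂P| ≤ K := by
      intro h K hK
      simpa using norm_integral_le_of_norm_le_const (μ := P) (f := h) (Eventually.of_forall hK)
    have hgC : ∀ ω, |g ω| ≤ C := fun ω => habs _ _ fun x => hC _
    have hgr : ∀ ω i x, |g (Function.update ω i x) - g ω| ≤ r := by
      intro ω i x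
      rw [hg]
      dsimp only
      rw [← integral_sub (hfωint _) (hfωint _)]
      refine habs _ _ fun y => ?_
      rw [Fin.cons_update]
      exact hr _ _ _
    have hEg : ∫ ω, f ω ∂(Measure.pi fun _ : Fin (n + 1) => P) = ∫ ω, g ω ∂Q := by
      rw [hint, integral_prod_symm _ hfint]
    rw [hint, hEg]
    set m := ∫ ω, g ω ∂Q with hm
    have hmC : ∀ ω, |s * (g ω - m)| ≤ |s| * (C + |m|) := fun ω => by
      rw [abs_mul]
      gcongr
      exact (abs_sub _ _).trans (by gcongr; exact hgC _)
    have hfmC : ∀ ω, |s * (f ω - m)| ≤ |s| * (C + |m|) := fun ω => by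
      rw [abs_mul]
      gcongr
      exact (abs_sub _ _).trans (by gcongr; exact hC _)
    rw [integral_prod_symm _ (integrable_exp_of_abs_le ((hfc.sub_const m).const_mul s)
      fun p => hfmC _)]
    have hinner : ∀ ω, ∫ x, Real.exp (s * (f (Fin.cons x ω) - m)) ∂P
        ≤ Real.exp (s * (g ω - m)) * Real.exp (s ^ 2 * r ^ 2 / 8) := by
      intro ω
      have h1 : ∀ x, Real.exp (s * (f (Fin.cons x ω) - m))
          = Real.exp (s * (g ω - m)) * Real.exp (s * (f (Fin.cons x ω) - g ω)) := by
        intro x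
        rw [← Real.exp_add]
        congr 1
        ring
      simp_rw [h1]
      rw [integral_const_mul]
      gcongr
      refine integral_exp_sub_integral_le P (hfω ω) (fun x y => ?_) s
      have := hr (Fin.cons y ω) 0 x
      rwa [Fin.update_cons_zero] at this
    calc _ ≤ ∫ ω, Real.exp (s * (g ω - m)) * Real.exp (s ^ 2 * r ^ 2 / 8) ∂Q := by
          refine integral_mono_of_nonneg (Eventually.of_forall fun ω =>
            integral_nonneg fun x => (Real.exp_pos _).le) ?_ (Eventually.of_forall hinner)
          exact (integrable_exp_of_abs_le ((hgm.sub_const m).const_mul s) hmC).mul_const _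
      _ ≤ Real.exp (s ^ 2 * (n * r ^ 2) / 8) * Real.exp (s ^ 2 * r ^ 2 / 8) := by
          rw [integral_mul_const]
          gcongr
          exact ih g hgm hgC hgr
      _ = _ := by
          rw [← Real.exp_add]
          congr 1
          push_cast
          ring

/-- McDiarmid's bounded differences inequality. -/
theorem measure_sub_integral_ge_le_of_bounded_differences {Ξ : Type*} [MeasurableSpace Ξ]
    (P : Measure Ξ) [IsProbabilityMeasure P] {n : ℕ} (hn : 0 < n) {f : (Fin n → Ξ) → ℝ}
    (hf : Measurable f) {C r : ℝ} (hC : ∀ ω, |f ω| ≤ C) (hr0 : 0 < r)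
    (hr : ∀ ω i x, |f (Function.update ω i x) - f ω| ≤ r) {ε : ℝ} (hε : 0 ≤ ε) :
    (Measure.pi fun _ : Fin n => P).real
        {ω | ε ≤ f ω - ∫ ω', f ω' ∂Measure.pi fun _ : Fin n => P}
      ≤ Real.exp (-2 * ε ^ 2 / (n * r ^ 2)) := by
  set μ := Measure.pi fun _ : Fin n => P with hμ
  set m := ∫ ω', f ω' ∂μ with hm
  have hn' : (0 : ℝ) < n := by exact_mod_cast hn
  set s := 4 * ε / (n * r ^ 2) with hs
  have hs0 : 0 ≤ s := by positivity
  have hb : ∀ ω, |s * (f ω - m)| ≤ |s| * (C + |m|) := fun ω => by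
    rw [abs_mul]
    gcongr
    exact (abs_sub _ _).trans (by gcongr; exact hC _)
  have h := ProbabilityTheory.measure_ge_le_exp_mul_mgf (μ := μ) (X := fun ω => f ω - m) ε hs0
    (integrable_exp_of_abs_le ((hf.sub_const m).const_mul s) hb)
  refine h.trans ?_
  have h2 := integral_exp_sub_integral_le_of_bounded_differences P n f hf C r hC hr s
  rw [ProbabilityTheory.mgf]
  calc _ ≤ Real.exp (-s * ε) * Real.exp (s ^ 2 * (n * r ^ 2) / 8) := by gcongr
    _ = _ := by
      rw [← Real.exp_add]
      congr 1
      rw [hs]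
      field_simp
      ring

theorem measurable_finset_sup'_apply {Ω ι : Type*} [MeasurableSpace Ω] (J : Finset ι)
    (hJ : J.Nonempty) {Y : ι → Ω → ℝ} (hY : ∀ j, Measurable (Y j)) :
    Measurable fun ω => J.sup' hJ fun j => Y j ω := by
  have h := Finset.measurable_sup' hJ (fun j _ => hY j)
  have h2 : J.sup' hJ Y = fun ω => J.sup' hJ fun j => Y j ω := funext fun ω =>
    Finset.sup'_apply hJ Y ω
  rwa [h2] at h

/-- Maximal inequality for finitely many sub-Gaussian variables. -/
theorem integral_sup'_le_of_subgaussian {Ω ι : Type*} [MeasurableSpace Ω] (μ : Measure Ω)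
    [IsProbabilityMeasure μ] (J : Finset ι) (hJ : J.Nonempty) (Y : ι → Ω → ℝ)
    (hY : ∀ j, Measurable (Y j)) {C : ℝ} (hC : ∀ j ω, |Y j ω| ≤ C) {σ a : ℝ} (hσ : 0 ≤ σ)
    (ha : Real.log J.card ≤ a)
    (hmgf : ∀ j ∈ J, ∀ s, ∫ ω, Real.exp (s * Y j ω) ∂μ ≤ Real.exp (s ^ 2 * σ ^ 2 / 2)) :
    ∫ ω, J.sup' hJ (fun j => Y j ω) ∂μ ≤ σ * Real.sqrt (2 * a) := by
  have hcard : (1 : ℝ) ≤ J.card := by exact_mod_cast hJ.card_pos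
  have ha0 : 0 ≤ a := (Real.log_nonneg hcard).trans ha
  have hsupm : Measurable fun ω => J.sup' hJ (fun j => Y j ω) :=
    measurable_finset_sup'_apply J hJ hY
  have hsupC : ∀ ω, |J.sup' hJ (fun j => Y j ω)| ≤ C := by
    intro ω
    obtain ⟨j, _, hj⟩ := Finset.exists_mem_eq_sup' hJ (fun j => Y j ω)
    rw [hj]
    exact hC j ω
  set x := ∫ ω, J.sup' hJ (fun j => Y j ω) ∂μ with hx
  have hmul : ∀ (g : Ω → ℝ), (∀ ω, |g ω| ≤ C) → ∀ s ω, |s * g ω| ≤ |s| * C := by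
    intro g hg s ω
    rw [abs_mul]
    gcongr
    exact hg ω
  have hpos : ∀ s, 0 ≤ s → s * x ≤ a + s ^ 2 * σ ^ 2 / 2 := by
    intro s hs
    have hexp : Real.exp (s * x) ≤ Real.exp (a + s ^ 2 * σ ^ 2 / 2) := by
      calc Real.exp (s * x) ≤ ∫ ω, Real.exp (s * J.sup' hJ (fun j => Y j ω)) ∂μ := by
            rw [hx, ← integral_const_mul]
            exact convexOn_exp.map_integral_le Real.continuous_exp.continuousOn isClosed_univ
              (by simp) (integrable_of_abs_le (hsupm.const_mul s) (hmul _ hsupC s))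
              (integrable_exp_of_abs_le (hsupm.const_mul s) (hmul _ hsupC s))
        _ ≤ ∫ ω, ∑ j ∈ J, Real.exp (s * Y j ω) ∂μ := by
            refine integral_mono (integrable_exp_of_abs_le (hsupm.const_mul s) (hmul _ hsupC s))
              (integrable_finsetSum _ fun j _ =>
                integrable_exp_of_abs_le ((hY j).const_mul s) (hmul _ (hC j) s)) fun ω => ?_
            obtain ⟨j, hjJ, hj⟩ := Finset.exists_mem_eq_sup' hJ (fun j => Y j ω)
            dsimp only
            rw [hj]
            exact Finset.single_le_sum (f := fun j => Real.exp (s * Y j ω))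
              (fun i _ => (Real.exp_pos _).le) hjJ
        _ = ∑ j ∈ J, ∫ ω, Real.exp (s * Y j ω) ∂μ :=
            integral_finsetSum _ fun j _ =>
              integrable_exp_of_abs_le ((hY j).const_mul s) (hmul _ (hC j) s)
        _ ≤ ∑ j ∈ J, Real.exp (s ^ 2 * σ ^ 2 / 2) := Finset.sum_le_sum fun j hj => hmgf j hj s
        _ = J.card * Real.exp (s ^ 2 * σ ^ 2 / 2) := by simp
        _ ≤ Real.exp a * Real.exp (s ^ 2 * σ ^ 2 / 2) := by
            gcongr
            exact (Real.log_le_iff_le_exp (by linarith)).1 ha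
        _ = _ := (Real.exp_add _ _).symm
    exact Real.exp_le_exp.1 hexp
  rcases le_or_gt x 0 with hx0 | hx0
  · exact hx0.trans (mul_nonneg hσ (Real.sqrt_nonneg _))
  have hquad : ∀ s : ℝ, 0 ≤ (σ ^ 2 / 2) * (s * s) + (-x) * s + a := by
    intro s
    rcases le_total 0 s with hs | hs
    · have := hpos s hs
      nlinarith
    · have : 0 ≤ -s * x := mul_nonneg (by linarith) hx0.le
      have : 0 ≤ σ ^ 2 / 2 * (s * s) := mul_nonneg (by positivity) (mul_self_nonneg s)
      linarith
  have hd := discrim_le_zero hquad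
  rw [discrim] at hd
  have : x ≤ Real.sqrt (σ ^ 2 * (2 * a)) := Real.le_sqrt_of_sq_le (by nlinarith)
  rwa [Real.sqrt_mul (sq_nonneg _), Real.sqrt_sq hσ] at this

/-- Difference between the expectation of `g` and its empirical mean along the sample `ω`. -/
def empDev {Ξ : Type*} [MeasurableSpace Ξ] (P : Measure Ξ) {n : ℕ} (g : Ξ → ℝ)
    (ω : Fin n → Ξ) : ℝ :=
  ∫ x, g x ∂P - (∑ i, g (ω i)) / n

section EmpDev

variable {Ξ : Type*} [MeasurableSpace Ξ] {P : Measure Ξ} {n : ℕ}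

theorem measurable_empDev {g : Ξ → ℝ} (hg : Measurable g) :
    Measurable (empDev P g : (Fin n → Ξ) → ℝ) := by
  unfold empDev
  fun_prop

theorem empDev_sub [IsFiniteMeasure P] {g g' : Ξ → ℝ} (hg : Integrable g P)
    (hg' : Integrable g' P) (ω : Fin n → Ξ) :
    empDev P (fun x => g x - g' x) ω = empDev P g ω - empDev P g' ω := by
  unfold empDev
  rw [integral_sub hg hg', Finset.sum_sub_distrib]
  ring

theorem abs_empDev_le [IsProbabilityMeasure P] (hn : 0 < n) {g : Ξ → ℝ} {d : ℝ}
    (hd : ∀ x, |g x| ≤ d) (ω : Fin n → Ξ) : |empDev P g ω| ≤ 2 * d := by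
  have hn' : (0 : ℝ) < n := by exact_mod_cast hn
  have h1 : |∫ x, g x ∂P| ≤ d := by
    simpa using norm_integral_le_of_norm_le_const (μ := P) (f := g) (Eventually.of_forall hd)
  have h2 : |(∑ i, g (ω i)) / n| ≤ d := by
    rw [abs_div, abs_of_pos hn', div_le_iff₀ hn']
    calc _ ≤ ∑ i, |g (ω i)| := Finset.abs_sum_le_sum_abs _ _
      _ ≤ ∑ _i : Fin n, d := Finset.sum_le_sum fun i _ => hd _
      _ = d * n := by simp [mul_comm]
  unfold empDev
  exact (abs_sub _ _).trans (by linarith)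

theorem abs_empDev_update_sub_le {g : Ξ → ℝ} {r : ℝ} (hr : ∀ x y, |g x - g y| ≤ r)
    (ω : Fin n → Ξ) (i : Fin n) (x : Ξ) :
    |empDev P g (Function.update ω i x) - empDev P g ω| ≤ r / n := by
  have h : ∑ j, g (Function.update ω i x j) = ∑ j, g (ω j) + (g x - g (ω i)) := by
    have h1 : ∀ j, g (Function.update ω i x j)
        = g (ω j) + if j = i then g x - g (ω i) else 0 := by
      intro j
      by_cases hj : j = i
      · subst hj
        simp
      · simp [hj]
    simp_rw [h1, Finset.sum_add_distrib]
    simp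
  unfold empDev
  rw [h]
  have h2 : ∫ x, g x ∂P - (∑ j, g (ω j) + (g x - g (ω i))) / n
      - (∫ x, g x ∂P - (∑ j, g (ω j)) / n) = (g (ω i) - g x) / n := by ring
  rw [h2, abs_div, Nat.abs_cast]
  gcongr
  exact hr _ _

theorem integral_empDev [IsProbabilityMeasure P] (hn : 0 < n) {g : Ξ → ℝ} (hg : Integrable g P) :
    ∫ ω, empDev P g ω ∂(Measure.pi fun _ : Fin n => P) = 0 := by
  have hn' : (n : ℝ) ≠ 0 := by exact_mod_cast hn.ne'
  have hmp : ∀ i : Fin n, MeasurePreserving (fun ω : Fin n → Ξ => ω i)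
      (Measure.pi fun _ : Fin n => P) P := fun i => measurePreserving_eval (fun _ => P) i
  have hint : ∀ i : Fin n, Integrable (fun ω : Fin n → Ξ => g (ω i))
      (Measure.pi fun _ : Fin n => P) := fun i => (hmp i).integrable_comp_of_integrable hg
  have hval : ∀ i : Fin n, ∫ ω, g (ω i) ∂(Measure.pi fun _ : Fin n => P) = ∫ x, g x ∂P := by
    intro i
    conv_rhs => rw [← (hmp i).map_eq]
    rw [integral_map (hmp i).measurable.aemeasurable]
    rw [(hmp i).map_eq]
    exact hg.aestronglyMeasurable
  unfold empDev
  rw [integral_sub (integrable_const _) ((integrable_finsetSum _ fun i _ => hint i).div_const _),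
    integral_div, integral_finsetSum _ fun i _ => hint i]
  simp [hval]
  field_simp
  ring

theorem integral_exp_empDev_le [IsProbabilityMeasure P] (hn : 0 < n) {g : Ξ → ℝ}
    (hg : Measurable g) {d : ℝ} (hd : ∀ x, |g x| ≤ d) (s : ℝ) :
    ∫ ω, Real.exp (s * empDev P g ω) ∂(Measure.pi fun _ : Fin n => P)
      ≤ Real.exp (s ^ 2 * (d / Real.sqrt n) ^ 2 / 2) := by
  have hn' : (0 : ℝ) < n := by exact_mod_cast hn
  have h := integral_exp_sub_integral_le_of_bounded_differences P n (empDev P g)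
    (measurable_empDev hg) (2 * d) (2 * d / n) (abs_empDev_le hn hd)
    (abs_empDev_update_sub_le fun x y => (abs_sub _ _).trans (by linarith [hd x, hd y])) s
  rw [integral_empDev hn (integrable_of_abs_le hg hd)] at h
  simp only [sub_zero] at h
  refine h.trans (Real.exp_le_exp.2 (le_of_eq ?_))
  rw [div_pow d, Real.sq_sqrt hn'.le]
  field_simp
  ring

end EmpDev

/-- A Riemann sum along a dyadic sequence is at most twice the integral of an antitone function. -/
theorem sum_dyadic_mul_le_integral {u : ℝ → ℝ} (hu0 : ∀ ε, 0 < ε → 0 ≤ u ε)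
    (hua : AntitoneOn u (Ioi 0)) (hui : IntegrableOn u (Ioi 0)) {D : ℝ} (hD : 0 < D) (K : ℕ) :
    ∑ k ∈ Finset.range K, D / 2 ^ (k + 1) * u (D / 2 ^ (k + 1)) ≤ 2 * ∫ t in Ioi 0, u t := by
  set e : ℕ → ℝ := fun k => D / 2 ^ k with he
  have hepos : ∀ k, 0 < e k := fun k => by positivity
  have hehalf : ∀ k, e k = 2 * e (k + 1) := fun k => by
    simp only [he, pow_succ]
    field_simp
  have hii : ∀ a b, 0 < a → 0 < b → IntervalIntegrable u volume a b := by
    intro a b ha hb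
    rw [intervalIntegrable_iff]
    refine hui.mono_set fun x hx => ?_
    exact (lt_min ha hb).trans hx.1
  have hstep : ∀ k, e (k + 1) * u (e (k + 1)) ≤ 2 * ∫ t in (e (k + 2))..(e (k + 1)), u t := by
    intro k
    have hle : e (k + 2) ≤ e (k + 1) := by linarith [hehalf (k + 1), hepos (k + 2)]
    have h := intervalIntegral.integral_mono_on hle intervalIntegrable_const
      (hii _ _ (hepos (k + 2)) (hepos (k + 1))) (f := fun _ => u (e (k + 1)))
      fun x hx => hua (mem_Ioi.2 ((hepos _).trans_le hx.1)) (mem_Ioi.2 (hepos _)) hx.2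
    rw [intervalIntegral.integral_const, smul_eq_mul] at h
    have : e (k + 1) - e (k + 2) = e (k + 1) / 2 := by linarith [hehalf (k + 1)]
    rw [this] at h
    linarith
  have hsum : ∀ K, ∑ k ∈ Finset.range K, e (k + 1) * u (e (k + 1))
      ≤ 2 * ∫ t in (e (K + 1))..(e 1), u t := by
    intro K
    induction K with
    | zero => simp
    | succ K ih =>
      rw [Finset.sum_range_succ, ← intervalIntegral.integral_add_adjacent_intervals
        (hii _ _ (hepos (K + 2)) (hepos (K + 1))) (hii _ _ (hepos (K + 1)) (hepos 1))]
      linarith [hstep K]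
  refine (hsum K).trans ?_
  have hle : e (K + 1) ≤ e 1 := by
    simp only [he]
    gcongr
    · norm_num
    · omega
  rw [intervalIntegral.integral_of_le hle]
  refine mul_le_mul_of_nonneg_left (setIntegral_mono_set hui ?_ ?_) zero_le_two
  · filter_upwards [ae_restrict_mem measurableSet_Ioi] with t ht using hu0 t ht
  · exact LE.le.eventuallyLE fun x hx => mem_Ioi.2 ((hepos _).trans hx.1)

/-- Dudley's chaining bound for the expected one-sided uniform deviation of an empirical process
over a finite subfamily. -/
theorem integral_sup'_empDev_le {Ξ : Type*} [MeasurableSpace Ξ] (P : Measure Ξ)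
    [IsProbabilityMeasure P] {n : ℕ} (hn : 0 < n) {T : Type*} [PseudoMetricSpace T]
    (h : T → Ξ → ℝ) (hm : ∀ t, Measurable (h t)) {B : ℝ} (hB : ∀ t x, |h t x| ≤ B)
    {L : ℝ} (hL0 : 0 ≤ L) (hL : ∀ s t x, |h s x - h t x| ≤ L * dist s t)
    {u : ℝ → ℝ} (hu0 : ∀ ε, 0 < ε → 0 ≤ u ε) (hua : AntitoneOn u (Ioi 0))
    (hui : IntegrableOn u (Ioi 0))
    (hnet : ∀ ε, 0 < ε →
      ∃ A : Finset T, (∀ t, ∃ y ∈ A, dist t y ≤ ε) ∧ Real.log A.card ≤ u ε ^ 2)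
    (S : Finset T) (hS : S.Nonempty) :
    ∫ ω, S.sup' hS (fun t => empDev P (h t) ω) ∂(Measure.pi fun _ : Fin n => P)
      ≤ 12 * L * (∫ t in Ioi 0, u t) / Real.sqrt n := by
  classical
  have hn' : (0 : ℝ) < n := by exact_mod_cast hn
  have hsqrt : 0 < Real.sqrt n := Real.sqrt_pos.2 hn'
  set μ := Measure.pi fun _ : Fin n => P with hμ
  obtain ⟨t₀, ht₀⟩ := hS
  have hSne : S.Nonempty := ⟨t₀, ht₀⟩
  obtain ⟨D, hD, hDt⟩ : ∃ D : ℝ, 0 < D ∧ ∀ t : T, dist t t₀ ≤ D := by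
    obtain ⟨A, hA, -⟩ := hnet 1 one_pos
    refine ⟨1 + ∑ y ∈ A, dist y t₀, ?_, fun t => ?_⟩
    · have : 0 ≤ ∑ y ∈ A, dist y t₀ := Finset.sum_nonneg fun _ _ => dist_nonneg
      linarith
    · obtain ⟨y, hy, hty⟩ := hA t
      have h1 : dist y t₀ ≤ ∑ y ∈ A, dist y t₀ :=
        Finset.single_le_sum (f := fun y => dist y t₀) (fun _ _ => dist_nonneg) hy
      linarith [dist_triangle t y t₀]
  set e : ℕ → ℝ := fun k => D / 2 ^ k with he
  have hepos : ∀ k, 0 < e k := fun k => by positivity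
  have hehalf : ∀ k, e k = 2 * e (k + 1) := fun k => by
    simp only [he, pow_succ]
    field_simp
  have hnets : ∀ k, ∃ A : Finset T, ∃ p : T → T, (∀ t, p t ∈ A ∧ dist t (p t) ≤ e k) ∧
      Real.log A.card ≤ u (e k) ^ 2 ∧ (k = 0 → ∀ t, p t = t₀) := by
    intro k
    rcases Nat.eq_zero_or_pos k with rfl | hk
    · refine ⟨{t₀}, fun _ => t₀, fun t => ⟨by simp, ?_⟩, ?_, fun _ _ => rfl⟩
      · simpa [he] using hDt t
      · simpa using sq_nonneg _
    · obtain ⟨A, hA, hAc⟩ := hnet (e k) (hepos k)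
      choose p hp using hA
      exact ⟨A, p, hp, hAc, fun h0 => absurd h0 hk.ne'⟩
  choose A p hp hAc hp0 using hnets
  have hgint : ∀ t, Integrable (h t) P := fun t => integrable_of_abs_le (hm t) (hB t)
  have hsub : ∀ s t (ω : Fin n → Ξ), empDev P (h s) ω - empDev P (h t) ω
      = empDev P (fun x => h s x - h t x) ω := fun s t ω =>
    (empDev_sub (hgint s) (hgint t) ω).symm
  set J : ℕ → Finset (T × T) := fun k =>
    (A (k + 1) ×ˢ A k).filter fun q => dist q.1 q.2 ≤ 3 * e (k + 1) with hJ
  have hmemJ : ∀ k t, (p (k + 1) t, p k t) ∈ J k := by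
    intro k t
    simp only [hJ, Finset.mem_filter, Finset.mem_product]
    refine ⟨⟨(hp _ _).1, (hp _ _).1⟩, ?_⟩
    have h1 := (hp (k + 1) t).2
    have h2 := (hp k t).2
    have h3 := dist_triangle_left (p (k + 1) t) (p k t) t
    rw [hehalf k] at h2
    linarith
  have hJne : ∀ k, (J k).Nonempty := fun k => ⟨_, hmemJ k t₀⟩
  set Y : T × T → (Fin n → Ξ) → ℝ := fun q ω => empDev P (fun x => h q.1 x - h q.2 x) ω with hY
  have hYm : ∀ q, Measurable (Y q) := fun q => measurable_empDev ((hm _).sub (hm _))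
  have hYC : ∀ q ω, |Y q ω| ≤ 2 * (2 * B) := fun q ω =>
    abs_empDev_le hn (fun x => (abs_sub _ _).trans (by linarith [hB q.1 x, hB q.2 x])) ω
  set W : ℕ → (Fin n → Ξ) → ℝ := fun k ω => (J k).sup' (hJne k) fun q => Y q ω with hW
  have hWbd : ∀ k, ∫ ω, W k ω ∂μ ≤ 6 * L / Real.sqrt n * (e (k + 1) * u (e (k + 1))) := by
    intro k
    have hle : e (k + 1) ≤ e k := by linarith [hehalf k, hepos (k + 1)]
    have huk : u (e k) ^ 2 ≤ u (e (k + 1)) ^ 2 :=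
      pow_le_pow_left₀ (hu0 _ (hepos k)) (hua (hepos (k + 1)) (hepos k) hle) 2
    have hcard : Real.log (J k).card ≤ 2 * u (e (k + 1)) ^ 2 := by
      have hc1 : 0 < (A (k + 1)).card := Finset.card_pos.2 ⟨_, (hp (k + 1) t₀).1⟩
      have hc2 : 0 < (A k).card := Finset.card_pos.2 ⟨_, (hp k t₀).1⟩
      have h1 : ((J k).card : ℝ) ≤ (A (k + 1)).card * (A k).card := by
        have := (A (k + 1) ×ˢ A k).card_filter_le fun q => dist q.1 q.2 ≤ 3 * e (k + 1)
        rw [Finset.card_product] at this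
        exact_mod_cast this
      have h2 : (0 : ℝ) < (J k).card := by exact_mod_cast (hJne k).card_pos
      calc _ ≤ Real.log ((A (k + 1)).card * (A k).card) := Real.log_le_log h2 h1
        _ = Real.log (A (k + 1)).card + Real.log (A k).card :=
          Real.log_mul (by exact_mod_cast hc1.ne') (by exact_mod_cast hc2.ne')
        _ ≤ _ := by linarith [hAc k, hAc (k + 1)]
    have h0 : 0 ≤ L * (3 * e (k + 1)) / Real.sqrt n := by
      have := hepos (k + 1)
      positivity
    refine (integral_sup'_le_of_subgaussian μ (J k) (hJne k) Y hYm hYC h0 hcard ?_).trans ?_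
    · intro q hq s
      refine integral_exp_empDev_le hn ((hm _).sub (hm _)) (fun x => ?_) s
      exact (hL _ _ x).trans (mul_le_mul_of_nonneg_left (Finset.mem_filter.1 hq).2 hL0)
    · have : 2 * (2 * u (e (k + 1)) ^ 2) = (2 * u (e (k + 1))) ^ 2 := by ring
      rw [this, Real.sqrt_sq (by linarith [hu0 _ (hepos (k + 1))])]
      refine le_of_eq ?_
      ring
  have hWm : ∀ k, Measurable (W k) := fun k => measurable_finset_sup'_apply (J k) (hJne k) hYm
  have hWint : ∀ k, Integrable (W k) μ := by
    intro k
    refine integrable_of_abs_le (hWm k) (C := 2 * (2 * B)) fun ω => ?_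
    obtain ⟨j, _, hj⟩ := Finset.exists_mem_eq_sup' (hJne k) (fun q => Y q ω)
    simp only [hW]
    rw [hj]
    exact hYC j ω
  have hMm : Measurable fun ω : Fin n → Ξ => S.sup' hSne (fun t => empDev P (h t) ω) :=
    measurable_finset_sup'_apply S hSne fun t => measurable_empDev (hm t)
  have hchain : ∀ K (ω : Fin n → Ξ), S.sup' hSne (fun t => empDev P (h t) ω)
      ≤ empDev P (h t₀) ω + ∑ k ∈ Finset.range K, W k ω + 2 * (L * e K) := by
    intro K ω
    refine Finset.sup'_le _ _ fun t _ => ?_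
    have h1 : empDev P (h (p K t)) ω - empDev P (h t₀) ω ≤ ∑ k ∈ Finset.range K, W k ω := by
      have h2 := Finset.sum_range_sub (fun k => empDev P (h (p k t)) ω) K
      rw [hp0 0 rfl t] at h2
      rw [← h2]
      refine Finset.sum_le_sum fun k _ => ?_
      rw [hsub]
      exact Finset.le_sup' (fun q => Y q ω) (hmemJ k t)
    have h2 : |empDev P (fun x => h t x - h (p K t) x) ω| ≤ 2 * (L * e K) :=
      abs_empDev_le hn (fun x => (hL _ _ x).trans
        (mul_le_mul_of_nonneg_left (hp K t).2 hL0)) ω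
    rw [← hsub] at h2
    linarith [le_abs_self (empDev P (h t) ω - empDev P (h (p K t)) ω)]
  have hK : ∀ K, ∫ ω, S.sup' hSne (fun t => empDev P (h t) ω) ∂μ
      ≤ 12 * L * (∫ t in Ioi 0, u t) / Real.sqrt n + 2 * (L * e K) := by
    intro K
    have hZint : Integrable (empDev P (h t₀) : (Fin n → Ξ) → ℝ) μ :=
      integrable_of_abs_le (measurable_empDev (hm _)) (abs_empDev_le hn (hB t₀))
    have hsumint : Integrable (fun ω => ∑ k ∈ Finset.range K, W k ω) μ :=
      integrable_finsetSum _ fun k _ => hWint k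
    have hMint : Integrable (fun ω : Fin n → Ξ => S.sup' hSne (fun t => empDev P (h t) ω)) μ := by
      refine integrable_of_abs_le hMm (C := 2 * B) fun ω => ?_
      obtain ⟨j, _, hj⟩ := Finset.exists_mem_eq_sup' hSne (fun t => empDev P (h t) ω)
      rw [hj]
      exact abs_empDev_le hn (hB j) ω
    calc _ ≤ ∫ ω, (empDev P (h t₀) ω + ∑ k ∈ Finset.range K, W k ω + 2 * (L * e K)) ∂μ :=
          integral_mono hMint ((hZint.add hsumint).add (integrable_const _)) (hchain K)
      _ = ∑ k ∈ Finset.range K, ∫ ω, W k ω ∂μ + 2 * (L * e K) := by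
          have h1 := integral_add (hZint.add hsumint) (integrable_const (2 * (L * e K)))
          simp only [Pi.add_apply] at h1
          rw [h1, integral_add hZint hsumint, integral_empDev hn (hgint t₀),
            integral_finsetSum _ fun k _ => hWint k]
          simp
      _ ≤ ∑ k ∈ Finset.range K, 6 * L / Real.sqrt n * (e (k + 1) * u (e (k + 1)))
            + 2 * (L * e K) := by
          gcongr with k
          exact hWbd k
      _ ≤ 6 * L / Real.sqrt n * (2 * ∫ t in Ioi 0, u t) + 2 * (L * e K) := by
          rw [← Finset.mul_sum]
          gcongr
          exact sum_dyadic_mul_le_integral hu0 hua hui hD K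
      _ = _ := by ring
  have hlim : Tendsto (fun K => 12 * L * (∫ t in Ioi 0, u t) / Real.sqrt n + 2 * (L * e K))
      atTop (nhds (12 * L * (∫ t in Ioi 0, u t) / Real.sqrt n + 2 * (L * 0))) := by
    have he0 : Tendsto e atTop (nhds 0) :=
      tendsto_const_nhds.div_atTop (tendsto_pow_atTop_atTop_of_one_lt one_lt_two)
    exact ((he0.const_mul L).const_mul 2).const_add _
  simpa using ge_of_tendsto' hlim hK

/-- High-probability uniform deviation bound for an empirical process with finite entropy
integral. -/
theorem measure_not_forall_empDev_le {Ξ : Type*} [MeasurableSpace Ξ] (P : Measure Ξ)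
    [IsProbabilityMeasure P] {n : ℕ} (hn : 0 < n) {T : Type*} [PseudoMetricSpace T]
    (h : T → Ξ → ℝ) (hm : ∀ t, Measurable (h t)) {B : ℝ} (hB0 : 0 < B)
    (hB : ∀ t x, |h t x| ≤ B)
    {L : ℝ} (hL0 : 0 ≤ L) (hL : ∀ s t x, |h s x - h t x| ≤ L * dist s t)
    {u : ℝ → ℝ} (hu0 : ∀ ε, 0 < ε → 0 ≤ u ε) (hua : AntitoneOn u (Ioi 0))
    (hui : IntegrableOn u (Ioi 0))
    (hnet : ∀ ε, 0 < ε →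
      ∃ A : Finset T, (∀ t, ∃ y ∈ A, dist t y ≤ ε) ∧ Real.log A.card ≤ u ε ^ 2)
    {δ : ℝ} (hδ : δ ∈ Ioo (0 : ℝ) 1) :
    (Measure.pi fun _ : Fin n => P) {ω | ¬ ∀ t, empDev P (h t) ω ≤
        (48 * L * (∫ t in Ioi 0, u t) + 2 * B * Real.sqrt (2 * Real.log (2 / δ))) / Real.sqrt n}
      ≤ ENNReal.ofReal (δ / 2) := by
  rcases isEmpty_or_nonempty T with hT | ⟨⟨t₀⟩⟩
  · simp
  obtain ⟨hδ0, hδ1⟩ := hδ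
  have hn' : (0 : ℝ) < n := by exact_mod_cast hn
  have hsqrt : 0 < Real.sqrt n := Real.sqrt_pos.2 hn'
  have hlog : 0 < Real.log (2 / δ) := Real.log_pos (by rw [lt_div_iff₀ hδ0]; linarith)
  have hI : 0 ≤ ∫ t in Ioi 0, u t := setIntegral_nonneg measurableSet_Ioi fun t ht => hu0 t ht
  set μ := Measure.pi fun _ : Fin n => P with hμ
  set r := B * Real.sqrt (2 * Real.log (2 / δ)) / Real.sqrt n with hr
  have hr0 : 0 < r := by
    have := Real.sqrt_pos.2 (mul_pos two_pos hlog)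
    positivity
  obtain ⟨A, hA, -⟩ := hnet (r / (2 * L + 1)) (by positivity)
  have hAne : A.Nonempty := ⟨_, (hA t₀).choose_spec.1⟩
  set M : (Fin n → Ξ) → ℝ := fun ω => A.sup' hAne fun t => empDev P (h t) ω with hM
  have hMm : Measurable M := measurable_finset_sup'_apply A hAne fun t => measurable_empDev (hm t)
  have hMC : ∀ ω, |M ω| ≤ 2 * B := by
    intro ω
    obtain ⟨j, _, hj⟩ := Finset.exists_mem_eq_sup' hAne (fun t => empDev P (h t) ω)
    simp only [hM]
    rw [hj]
    exact abs_empDev_le hn (hB j) ω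
  have hupd : ∀ t (ω : Fin n → Ξ) i x,
      |empDev P (h t) (Function.update ω i x) - empDev P (h t) ω| ≤ 2 * B / n := fun t =>
    abs_empDev_update_sub_le fun x y => (abs_sub _ _).trans (by linarith [hB t x, hB t y])
  have hMr : ∀ ω i x, |M (Function.update ω i x) - M ω| ≤ 2 * B / n := by
    intro ω i x
    have h1 : M (Function.update ω i x) ≤ M ω + 2 * B / n := by
      refine Finset.sup'_le _ _ fun t ht => ?_
      have h2 := Finset.le_sup' (fun t => empDev P (h t) ω) ht
      have h3 := (abs_le.1 (hupd t ω i x)).2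
      simp only [hM]
      linarith
    have h1' : M ω ≤ M (Function.update ω i x) + 2 * B / n := by
      refine Finset.sup'_le _ _ fun t ht => ?_
      have h2 := Finset.le_sup' (fun t => empDev P (h t) (Function.update ω i x)) ht
      have h3 := (abs_le.1 (hupd t ω i x)).1
      simp only [hM]
      linarith
    exact abs_le.2 ⟨by linarith, by linarith⟩
  have hEM : ∫ ω, M ω ∂μ ≤ 12 * L * (∫ t in Ioi 0, u t) / Real.sqrt n :=
    integral_sup'_empDev_le P hn h hm hB hL0 hL hu0 hua hui hnet A hAne
  have htail := measure_sub_integral_ge_le_of_bounded_differences P hn hMm hMC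
    (div_pos (mul_pos two_pos hB0) hn') hMr hr0.le
  have hexp : -2 * r ^ 2 / (n * (2 * B / n) ^ 2) = -Real.log (2 / δ) := by
    rw [hr, div_pow, mul_pow, Real.sq_sqrt hn'.le, Real.sq_sqrt (by positivity)]
    field_simp
  rw [hexp, Real.exp_neg, Real.exp_log (by positivity), inv_div] at htail
  calc _ ≤ μ {ω | r ≤ M ω - ∫ ω', M ω' ∂μ} := by
        refine measure_mono fun ω hω => ?_
        by_contra hlt
        simp only [mem_ofPred_eq, not_le] at hlt
        refine hω fun t => ?_
        obtain ⟨y, hy, hty⟩ := hA t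
        have h1 : empDev P (h y) ω ≤ M ω := Finset.le_sup' (fun t => empDev P (h t) ω) hy
        have h2 : |empDev P (fun x => h t x - h y x) ω| ≤ 2 * (L * (r / (2 * L + 1))) :=
          abs_empDev_le hn (fun x => (hL _ _ x).trans (mul_le_mul_of_nonneg_left hty hL0)) ω
        rw [empDev_sub (integrable_of_abs_le (hm t) (hB t))
          (integrable_of_abs_le (hm y) (hB y))] at h2
        have h3 : 2 * (L * (r / (2 * L + 1))) ≤ r := by
          have : 2 * (L * (r / (2 * L + 1))) = r * (2 * L / (2 * L + 1)) := by ring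
          rw [this]
          refine mul_le_of_le_one_right hr0.le ?_
          rw [div_le_one (by positivity)]
          linarith
        have h4 : (48 * L * (∫ t in Ioi 0, u t) + 2 * B * Real.sqrt (2 * Real.log (2 / δ)))
            / Real.sqrt n = 12 * L * (∫ t in Ioi 0, u t) / Real.sqrt n + 2 * r
              + 36 * L * (∫ t in Ioi 0, u t) / Real.sqrt n := by
          rw [hr]
          ring
        have h5 : 0 ≤ 36 * L * (∫ t in Ioi 0, u t) / Real.sqrt n := by positivity
        rw [h4]
        linarith [le_abs_self (empDev P (h t) ω - empDev P (h y) ω)]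
    _ ≤ ENNReal.ofReal (δ / 2) := by
        rw [← ENNReal.ofReal_toReal (measure_ne_top μ _)]
        exact ENNReal.ofReal_le_ofReal htail

theorem dualGen_smul {Ξ : Type*} [TopologicalSpace Ξ] {c : Ξ → Ξ → ℝ} {μ : ℝ} (hμ : 0 ≤ μ)
    (lam : ℝ) (f : C(Ξ, ℝ)) (ξ : Ξ) :
    dualGen c (μ * lam) (μ • f : C(Ξ, ℝ)) ξ = μ * dualGen c lam f ξ := by
  unfold dualGen
  rw [Real.mul_iSup_of_nonneg hμ]
  congr 1
  ext ζ
  simp only [ContinuousMap.coe_smul, Pi.smul_apply, smul_eq_mul]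
  ring

theorem transportCost_le {Ξ : Type*} [MeasurableSpace Ξ] {c : Ξ → Ξ → ℝ}
    (hc_nonneg : ∀ ξ ζ, 0 ≤ c ξ ζ) {Q Q' : Measure Ξ}
    (π : Measure (Ξ × Ξ)) [IsProbabilityMeasure π] (h1 : π.map Prod.fst = Q)
    (h2 : π.map Prod.snd = Q') : transportCost c Q Q' ≤ ∫ p, c p.1 p.2 ∂π := by
  refine csInf_le ⟨0, ?_⟩ ⟨π, inferInstance, h1, h2, rfl⟩
  rintro _ ⟨π', -, -, -, rfl⟩
  exact integral_nonneg fun p => hc_nonneg _ _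

theorem integrable_of_continuous {α : Type*} [TopologicalSpace α] [CompactSpace α]
    [MeasurableSpace α] [OpensMeasurableSpace α] {μ : Measure α} [IsFiniteMeasure μ]
    {g : α → ℝ} (hg : Continuous g) : Integrable g μ :=
  integrable_of_abs_le hg.measurable (C := ‖(⟨g, hg⟩ : C(α, ℝ))‖) fun x =>
    (⟨g, hg⟩ : C(α, ℝ)).norm_coe_le_norm x

theorem bddAbove_robustRisk {Ξ : Type*} [MetricSpace Ξ] [CompactSpace Ξ] [MeasurableSpace Ξ]
    [BorelSpace Ξ] {c : Ξ → Ξ → ℝ} (ρ : ℝ) (Q : Measure Ξ) (f : C(Ξ, ℝ)) :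
    BddAbove { r | ∃ Q' : Measure Ξ, IsProbabilityMeasure Q' ∧ transportCost c Q Q' ≤ ρ ∧
      r = ∫ ξ, f ξ ∂Q' } := by
  refine ⟨‖f‖, ?_⟩
  rintro _ ⟨Q', hQ', -, rfl⟩
  calc ∫ ξ, f ξ ∂Q' ≤ ∫ _ξ, ‖f‖ ∂Q' := integral_mono (integrable_of_continuous f.continuous)
        (integrable_const _) fun ξ => (le_abs_self _).trans (f.norm_coe_le_norm ξ)
    _ = ‖f‖ := by simp

theorem integral_le_robustRisk {Ξ : Type*} [MetricSpace Ξ] [CompactSpace Ξ] [MeasurableSpace Ξ]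
    [BorelSpace Ξ] {c : Ξ → Ξ → ℝ} {ρ : ℝ} {Q Q' : Measure Ξ} [IsProbabilityMeasure Q']
    (h : transportCost c Q Q' ≤ ρ) (f : C(Ξ, ℝ)) : ∫ ξ, f ξ ∂Q' ≤ robustRisk c ρ Q f :=
  le_csSup (bddAbove_robustRisk ρ Q f) ⟨Q', inferInstance, h, rfl⟩

theorem continuous_dualGen {Ξ : Type*} [TopologicalSpace Ξ] [CompactSpace Ξ] {c : Ξ → Ξ → ℝ}
    (hc : Continuous fun p : Ξ × Ξ => c p.1 p.2) (lam : ℝ)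
    (f : C(Ξ, ℝ)) : Continuous (dualGen c lam f) := by
  have h := IsCompact.continuous_sSup (f := fun ξ ζ => f ζ - lam * c ξ ζ) isCompact_univ
    ((f.continuous.comp continuous_snd).sub (hc.const_mul lam))
  simp only [image_univ, sSup_range] at h
  exact h

theorem transportCost_self_le {Ξ : Type*} [MetricSpace Ξ] [CompactSpace Ξ] [MeasurableSpace Ξ]
    [BorelSpace Ξ] {c : Ξ → Ξ → ℝ} (hc : Continuous fun p : Ξ × Ξ => c p.1 p.2)
    (hc_nonneg : ∀ ξ ζ, 0 ≤ c ξ ζ) (hc_self : ∀ ξ, c ξ ξ = 0)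
    (Q : Measure Ξ) [IsProbabilityMeasure Q] : transportCost c Q Q ≤ 0 := by
  have hd : Measurable fun ξ : Ξ => (ξ, ξ) := measurable_id.prodMk measurable_id
  have : IsProbabilityMeasure (Q.map fun ξ => (ξ, ξ)) :=
    Measure.isProbabilityMeasure_map hd.aemeasurable
  refine (transportCost_le hc_nonneg (Q.map fun ξ => (ξ, ξ)) ?_ ?_).trans ?_
  · rw [Measure.map_map measurable_fst hd]
    exact Measure.map_id
  · rw [Measure.map_map measurable_snd hd]
    exact Measure.map_id
  · rw [integral_map hd.aemeasurable hc.aestronglyMeasurable]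
    simp [hc_self]

theorem integral_le_robustRisk_self {Ξ : Type*} [MetricSpace Ξ] [CompactSpace Ξ]
    [MeasurableSpace Ξ] [BorelSpace Ξ] {c : Ξ → Ξ → ℝ} (hc : Continuous fun p : Ξ × Ξ => c p.1 p.2)
    (hc_nonneg : ∀ ξ ζ, 0 ≤ c ξ ζ) (hc_self : ∀ ξ, c ξ ξ = 0)
    (Q : Measure Ξ) [IsProbabilityMeasure Q] {ρ : ℝ} (hρ : 0 ≤ ρ) (f : C(Ξ, ℝ)) :
    ∫ ξ, f ξ ∂Q ≤ robustRisk c ρ Q f :=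
  integral_le_robustRisk ((transportCost_self_le hc hc_nonneg hc_self Q).trans hρ) f

section Dual

variable {Ξ : Type*} [MetricSpace Ξ] [CompactSpace Ξ] [Nonempty Ξ] {c : Ξ → Ξ → ℝ}

theorem exists_dualGen_eq (hc : Continuous fun p : Ξ × Ξ => c p.1 p.2) (lam : ℝ) (f : C(Ξ, ℝ))
    (ξ : Ξ) : ∃ ζ, dualGen c lam f ξ = f ζ - lam * c ξ ζ ∧
      ∀ ζ', f ζ' - lam * c ξ ζ' ≤ f ζ - lam * c ξ ζ := by
  have hcont : Continuous fun ζ => f ζ - lam * c ξ ζ :=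
    f.continuous.sub ((hc.comp (Continuous.prodMk_right ξ)).const_mul lam)
  obtain ⟨ζ, -, hζ⟩ := isCompact_univ.exists_isMaxOn univ_nonempty hcont.continuousOn
  have hmax : ∀ ζ', f ζ' - lam * c ξ ζ' ≤ f ζ - lam * c ξ ζ := fun ζ' => hζ (mem_univ ζ')
  have hbdd : BddAbove (range fun ζ => f ζ - lam * c ξ ζ) :=
    ⟨f ζ - lam * c ξ ζ, by rintro _ ⟨ζ', rfl⟩; exact hmax ζ'⟩
  exact ⟨ζ, le_antisymm (ciSup_le hmax) (le_ciSup hbdd ζ), hmax⟩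

theorem le_dualGen (hc : Continuous fun p : Ξ × Ξ => c p.1 p.2) (lam : ℝ) (f : C(Ξ, ℝ))
    (ξ ζ : Ξ) : f ζ - lam * c ξ ζ ≤ dualGen c lam f ξ := by
  obtain ⟨ζ', h, h'⟩ := exists_dualGen_eq hc lam f ξ
  rw [h]
  exact h' ζ

theorem abs_dualGen_sub_le (hc : Continuous fun p : Ξ × Ξ => c p.1 p.2) (lam : ℝ)
    (f g : C(Ξ, ℝ)) (ξ : Ξ) : |dualGen c lam f ξ - dualGen c lam g ξ| ≤ ‖f - g‖ := by
  have key : ∀ f g : C(Ξ, ℝ), dualGen c lam f ξ - dualGen c lam g ξ ≤ ‖f - g‖ := by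
    intro f g
    obtain ⟨ζ, h, -⟩ := exists_dualGen_eq hc lam f ξ
    have h2 := le_dualGen hc lam g ξ ζ
    have h3 := (le_abs_self _).trans ((f - g).norm_coe_le_norm ζ)
    rw [ContinuousMap.sub_apply] at h3
    linarith
  refine abs_le.2 ⟨?_, key f g⟩
  have := key g f
  rw [norm_sub_rev] at this
  linarith

theorem dualGen_le_norm (hc : Continuous fun p : Ξ × Ξ => c p.1 p.2)
    (hc_nonneg : ∀ ξ ζ, 0 ≤ c ξ ζ) {lam : ℝ} (hlam : 0 ≤ lam) (f : C(Ξ, ℝ)) (ξ : Ξ) :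
    dualGen c lam f ξ ≤ ‖f‖ := by
  obtain ⟨ζ, h, -⟩ := exists_dualGen_eq hc lam f ξ
  rw [h]
  have h1 := (le_abs_self _).trans (f.norm_coe_le_norm ζ)
  have h2 := mul_nonneg hlam (hc_nonneg ξ ζ)
  linarith

theorem neg_norm_le_dualGen (hc : Continuous fun p : Ξ × Ξ => c p.1 p.2)
    (hc_self : ∀ ξ, c ξ ξ = 0) (lam : ℝ) (f : C(Ξ, ℝ)) (ξ : Ξ) :
    -‖f‖ ≤ dualGen c lam f ξ := by
  have h := le_dualGen hc lam f ξ ξ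
  rw [hc_self] at h
  have h1 := (neg_le_abs _).trans (f.norm_coe_le_norm ξ)
  linarith

/-- The dual generator is nonincreasing in the multiplier, with decrement at least the
multiplier increment times the cost to the set of maximizers for the larger multiplier. -/
theorem mul_sInf_le_dualGen_sub (hc : Continuous fun p : Ξ × Ξ => c p.1 p.2)
    (hc_nonneg : ∀ ξ ζ, 0 ≤ c ξ ζ) {a b : ℝ} (hab : a ≤ b) (f : C(Ξ, ℝ)) (ξ : Ξ) :
    (b - a) * sInf (c ξ '' {ζ | ∀ ζ', f ζ' - b * c ξ ζ' ≤ f ζ - b * c ξ ζ})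
      ≤ dualGen c a f ξ - dualGen c b f ξ := by
  obtain ⟨ζ, h, h'⟩ := exists_dualGen_eq hc b f ξ
  have h1 : sInf (c ξ '' {ζ | ∀ ζ', f ζ' - b * c ξ ζ' ≤ f ζ - b * c ξ ζ}) ≤ c ξ ζ :=
    csInf_le ⟨0, by rintro _ ⟨ζ', -, rfl⟩; exact hc_nonneg _ _⟩ ⟨ζ, h', rfl⟩
  have h2 := mul_le_mul_of_nonneg_left h1 (sub_nonneg.2 hab)
  have h3 := le_dualGen hc a f ξ ζ
  rw [h]
  linarith

/-- Convexity of the dual generator in the multiplier, as a comparison of slopes. -/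
theorem mul_dualGen_sub_le (hc : Continuous fun p : Ξ × Ξ => c p.1 p.2) {x y z : ℝ}
    (hxy : x ≤ y) (hyz : y ≤ z) (f : C(Ξ, ℝ)) (ξ : Ξ) :
    (y - x) * (dualGen c y f ξ - dualGen c z f ξ)
      ≤ (z - y) * (dualGen c x f ξ - dualGen c y f ξ) := by
  obtain ⟨ζ, h, -⟩ := exists_dualGen_eq hc y f ξ
  have h1 := mul_le_mul_of_nonneg_left (le_dualGen hc x f ξ ζ) (sub_nonneg.2 hyz)
  have h2 := mul_le_mul_of_nonneg_left (le_dualGen hc z f ξ ζ) (sub_nonneg.2 hxy)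
  have h3 : (z - x) * dualGen c y f ξ = (z - x) * (f ζ - y * c ξ ζ) := by rw [h]
  nlinarith

variable [MeasurableSpace Ξ] [BorelSpace Ξ]

/-- Weak duality for the robust risk. -/
theorem robustRisk_le_dual (hc : Continuous fun p : Ξ × Ξ => c p.1 p.2)
    (hc_nonneg : ∀ ξ ζ, 0 ≤ c ξ ζ) (hc_self : ∀ ξ, c ξ ξ = 0)
    (Q : Measure Ξ) [IsProbabilityMeasure Q] {ρ : ℝ} (hρ : 0 ≤ ρ) (f : C(Ξ, ℝ))
    {lam : ℝ} (hlam : 0 ≤ lam) :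
    robustRisk c ρ Q f ≤ lam * ρ + ∫ ξ, dualGen c lam f ξ ∂Q := by
  refine csSup_le ⟨_, Q, inferInstance,
    (transportCost_self_le hc hc_nonneg hc_self Q).trans hρ, rfl⟩ ?_
  rintro _ ⟨Q', hQ', hW, rfl⟩
  have hlt : ∀ η, 0 < η →
      ∫ ξ, f ξ ∂Q' ≤ lam * ρ + ∫ ξ, dualGen c lam f ξ ∂Q + lam * η := by
    intro η hη
    obtain ⟨_, ⟨π, hπ, h1, h2, rfl⟩, hr⟩ := exists_lt_of_csInf_lt
      (s := { r | ∃ π : Measure (Ξ × Ξ), IsProbabilityMeasure π ∧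
        π.map Prod.fst = Q ∧ π.map Prod.snd = Q' ∧ r = ∫ p, c p.1 p.2 ∂π })
      ⟨_, Q.prod Q', inferInstance, by simp, by simp, rfl⟩ (hW.trans_lt (lt_add_of_pos_right ρ hη))
    have hφ := continuous_dualGen hc lam f
    have hφ1 : Continuous fun p : Ξ × Ξ => dualGen c lam f p.1 := hφ.comp continuous_fst
    calc ∫ ξ, f ξ ∂Q' = ∫ p, f p.2 ∂π := by
          rw [← h2, integral_map measurable_snd.aemeasurable f.continuous.aestronglyMeasurable]
      _ ≤ ∫ p, (dualGen c lam f p.1 + lam * c p.1 p.2) ∂π := by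
          refine integral_mono (integrable_of_continuous (f.continuous.comp continuous_snd))
            (integrable_of_continuous (hφ1.add (hc.const_mul lam)))
            fun p => ?_
          have := le_dualGen hc lam f p.1 p.2
          dsimp only
          linarith
      _ = ∫ p, dualGen c lam f p.1 ∂π + lam * ∫ p, c p.1 p.2 ∂π := by
          rw [integral_add (integrable_of_continuous hφ1)
            (integrable_of_continuous (hc.const_mul lam)), integral_const_mul]
      _ = ∫ ξ, dualGen c lam f ξ ∂Q + lam * ∫ p, c p.1 p.2 ∂π := by
          rw [← h1, integral_map measurable_fst.aemeasurable hφ.aestronglyMeasurable]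
      _ ≤ _ := by
          have := mul_le_mul_of_nonneg_left hr.le hlam
          linarith
  refine le_of_forall_pos_le_add fun ε hε => (hlt (ε / (lam + 1)) (by positivity)).trans ?_
  gcongr
  rw [← mul_div_assoc, div_le_iff₀ (by positivity)]
  nlinarith

end Dual

theorem isProbabilityMeasure_empiricalMeasure {α : Type*} [MeasurableSpace α] {n : ℕ} (hn : 0 < n)
    (ω : Fin n → α) : IsProbabilityMeasure (empiricalMeasure n ω) := by
  refine ⟨?_⟩
  simp only [empiricalMeasure, Measure.smul_apply, Measure.coe_finsetSum, Finset.sum_apply,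
    measure_univ, Finset.sum_const, Finset.card_univ, Fintype.card_fin, smul_eq_mul, nsmul_eq_mul,
    mul_one]
  exact ENNReal.inv_mul_cancel (by exact_mod_cast hn.ne') (ENNReal.natCast_ne_top n)

theorem integral_empiricalMeasure {α : Type*} [TopologicalSpace α] [CompactSpace α]
    [MeasurableSpace α] [OpensMeasurableSpace α] (n : ℕ)
    (ω : Fin n → α) {g : α → ℝ} (hg : Continuous g) :
    ∫ x, g x ∂(empiricalMeasure n ω) = (∑ i, g (ω i)) / n := by
  rw [empiricalMeasure, integral_smul_measure,
    integral_finsetSum_measure fun i _ => integrable_of_continuous hg]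
  simp_rw [integral_dirac' g _ hg.measurable.stronglyMeasurable]
  simp
  ring

theorem map_empiricalMeasure {α β : Type*} [MeasurableSpace α] [MeasurableSpace β] {n : ℕ}
    (ω : Fin n → α) {g : α → β} (hg : Measurable g) :
    (empiricalMeasure n ω).map g = empiricalMeasure n (fun i => g (ω i)) := by
  ext s hs
  rw [Measure.map_apply hg hs]
  simp only [empiricalMeasure, Measure.smul_apply, Measure.coe_finsetSum, Finset.sum_apply]
  congr 1
  refine Finset.sum_congr rfl fun i _ => ?_
  rw [Measure.dirac_apply' _ (hg hs), Measure.dirac_apply' _ hs]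
  rfl

/-- The set of pairs (transport cost, value) of couplings with a given first marginal is convex. -/
theorem convex_cost_value {Ξ : Type*} [MetricSpace Ξ] [CompactSpace Ξ] [MeasurableSpace Ξ]
    [BorelSpace Ξ] {c : Ξ → Ξ → ℝ} (hc : Continuous fun p : Ξ × Ξ => c p.1 p.2) (f : C(Ξ, ℝ))
    (Q : Measure Ξ) :
    Convex ℝ {q : ℝ × ℝ | ∃ π : Measure (Ξ × Ξ), IsProbabilityMeasure π ∧ π.map Prod.fst = Q ∧
      q = (∫ p, c p.1 p.2 ∂π, ∫ p, f p.2 ∂π)} := by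
  rintro _ ⟨π₁, hp₁, h₁, rfl⟩ _ ⟨π₂, hp₂, h₂, rfl⟩ a b ha hb hab
  have hab' : ENNReal.ofReal a + ENNReal.ofReal b = 1 := by
    rw [← ENNReal.ofReal_add ha hb, hab, ENNReal.ofReal_one]
  have hint : ∀ g : Ξ × Ξ → ℝ, Continuous g →
      ∫ p, g p ∂(ENNReal.ofReal a • π₁ + ENNReal.ofReal b • π₂)
        = a * ∫ p, g p ∂π₁ + b * ∫ p, g p ∂π₂ := by
    intro g hg
    rw [integral_add_measure
      ((integrable_of_continuous hg).smul_measure ENNReal.ofReal_ne_top)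
      ((integrable_of_continuous hg).smul_measure ENNReal.ofReal_ne_top),
      integral_smul_measure, integral_smul_measure, ENNReal.toReal_ofReal ha,
      ENNReal.toReal_ofReal hb, smul_eq_mul, smul_eq_mul]
  refine ⟨ENNReal.ofReal a • π₁ + ENNReal.ofReal b • π₂, ⟨?_⟩, ?_, ?_⟩
  · simpa using hab'
  · rw [Measure.map_add _ _ measurable_fst, Measure.map_smul, Measure.map_smul, h₁, h₂,
      ← add_smul, hab', one_smul]
  · have hf2 : Continuous fun p : Ξ × Ξ => f p.2 := f.continuous.comp continuous_snd
    rw [hint _ hc, hint _ hf2]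
    simp

/-- Strong duality for the robust risk centered at an empirical measure: a uniform lower bound on
the dual objective is a lower bound on the primal value. -/
theorem le_robustRisk_empiricalMeasure {Ξ : Type*} [MetricSpace Ξ] [CompactSpace Ξ] [Nonempty Ξ]
    [MeasurableSpace Ξ] [BorelSpace Ξ] {c : Ξ → Ξ → ℝ}
    (hc : Continuous fun p : Ξ × Ξ => c p.1 p.2) (hc_nonneg : ∀ ξ ζ, 0 ≤ c ξ ζ)
    (hc_self : ∀ ξ, c ξ ξ = 0) (f : C(Ξ, ℝ)) {n : ℕ} (hn : 0 < n) (ω : Fin n → Ξ)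
    {ρ V : ℝ} (hρ : 0 < ρ)
    (hV : ∀ lam, 0 ≤ lam → V ≤ lam * ρ + (∑ i, dualGen c lam f (ω i)) / n) :
    V ≤ robustRisk c ρ (empiricalMeasure n ω) f := by
  have hn' : (0 : ℝ) < n := by exact_mod_cast hn
  refine le_of_forall_lt fun V' hV' => ?_
  set A := {q : ℝ × ℝ | ∃ π : Measure (Ξ × Ξ), IsProbabilityMeasure π ∧
    π.map Prod.fst = empiricalMeasure n ω ∧ q = (∫ p, c p.1 p.2 ∂π, ∫ p, f p.2 ∂π)} with hA
  have hAmem : ∀ ζ : Fin n → Ξ, ((∑ i, c (ω i) (ζ i)) / n, (∑ i, f (ζ i)) / n) ∈ A := by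
    intro ζ
    refine ⟨empiricalMeasure n fun i => (ω i, ζ i),
      isProbabilityMeasure_empiricalMeasure hn _, map_empiricalMeasure _ measurable_fst, ?_⟩
    have hf2 : Continuous fun p : Ξ × Ξ => f p.2 := f.continuous.comp continuous_snd
    rw [integral_empiricalMeasure n _ hc, integral_empiricalMeasure n _ hf2]
  by_cases hdisj : Disjoint (Iio ρ ×ˢ Ioi V') A
  · exfalso
    obtain ⟨g, v, hg1, hg2⟩ := geometric_hahn_banach_open ((convex_Iio ρ).prod (convex_Ioi V'))
      (isOpen_Iio.prod isOpen_Ioi) (convex_cost_value hc f _) hdisj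
    have hgxy : ∀ x y, g (x, y) = x * g (1, 0) + y * g (0, 1) := by
      intro x y
      have : ((x, y) : ℝ × ℝ) = x • (1, 0) + y • (0, 1) := by simp
      rw [this, map_add, map_smul, map_smul, smul_eq_mul, smul_eq_mul]
    set p := g (1, 0) with hp
    set q := g (0, 1) with hq
    have hopen : ∀ x y, x < ρ → V' < y → x * p + y * q < v := fun x y hx hy => by
      rw [← hgxy]
      exact hg1 _ ⟨hx, hy⟩
    have hp0 : 0 ≤ p := by
      by_contra! hneg
      have h := hopen (min 0 ((v - (V' + 1) * q) / p) ⊓ (ρ - 1)) (V' + 1)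
        ((min_le_right _ _).trans_lt (by linarith)) (by linarith)
      have h1 : min 0 ((v - (V' + 1) * q) / p) ⊓ (ρ - 1) ≤ (v - (V' + 1) * q) / p :=
        (min_le_left _ _).trans (min_le_right _ _)
      have h2 := mul_le_mul_of_nonpos_right h1 hneg.le
      rw [div_mul_cancel₀ _ hneg.ne] at h2
      linarith
    have hq0 : q ≤ 0 := by
      by_contra! hpos
      have h := hopen (ρ - 1) (max (V' + 1) ((v - (ρ - 1) * p) / q)) (by linarith)
        ((lt_add_one V').trans_le (le_max_left _ _))
      have h1 := mul_le_mul_of_nonneg_right (le_max_right (V' + 1) ((v - (ρ - 1) * p) / q)) hpos.le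
      rw [div_mul_cancel₀ _ hpos.ne'] at h1
      linarith
    have hclosed : ρ * p + V' * q ≤ v := by
      refine le_of_forall_pos_le_add fun η hη => ?_
      have hκ : 0 < η / (p - q + 1) := div_pos hη (by linarith)
      have h := hopen (ρ - η / (p - q + 1)) (V' + η / (p - q + 1)) (by linarith) (by linarith)
      have h1 : η / (p - q + 1) * (p - q) ≤ η := by
        rw [div_mul_eq_mul_div, div_le_iff₀ (by linarith)]
        nlinarith
      nlinarith
    have hAv : ∀ ζ : Fin n → Ξ, v ≤ (∑ i, c (ω i) (ζ i)) / n * p + (∑ i, f (ζ i)) / n * q :=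
      fun ζ => by
        rw [← hgxy]
        exact hg2 _ (hAmem ζ)
    rcases hq0.eq_or_lt with hq0 | hq0
    · have h1 := hAv ω
      have h2 := hopen 0 (V' + 1) hρ (by linarith)
      simp only [hc_self, hq0] at h1 h2
      simp at h1 h2
      linarith
    · set lam := p / (-q) with hlam
      have hlam0 : 0 ≤ lam := div_nonneg hp0 (by linarith)
      have hplam : p = lam * (-q) := (div_mul_cancel₀ _ (by linarith)).symm
      choose ζ hζ _ using fun i => exists_dualGen_eq hc lam f (ω i)
      have h1 := hAv ζ
      have h2 := hV lam hlam0
      have h3 : (∑ i, dualGen c lam f (ω i)) / n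
          = (∑ i, f (ζ i)) / n - lam * ((∑ i, c (ω i) (ζ i)) / n) := by
        simp_rw [hζ, Finset.sum_sub_distrib, ← Finset.mul_sum]
        ring
      rw [h3] at h2
      rw [hplam] at h1 hclosed
      nlinarith
  · obtain ⟨_, ⟨hx, hy⟩, π, hπ, h1, rfl⟩ := not_disjoint_iff.1 hdisj
    have : IsProbabilityMeasure (π.map Prod.snd) :=
      Measure.isProbabilityMeasure_map measurable_snd.aemeasurable
    have hval : ∫ ξ, f ξ ∂(π.map Prod.snd) = ∫ p, f p.2 ∂π :=
      integral_map measurable_snd.aemeasurable f.continuous.aestronglyMeasurable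
    have h := integral_le_robustRisk ((transportCost_le hc_nonneg π h1 rfl).trans
      (le_of_lt hx)) f
    rw [hval] at h
    exact lt_of_lt_of_le hy h

theorem card_le_packingNum {Ξ : Type*} [TopologicalSpace Ξ] [CompactSpace Ξ] {F : Set C(Ξ, ℝ)}
    {t : ℝ} {s : Finset C(Ξ, ℝ)} (hs : ↑s ⊆ F)
    (hp : (s : Set C(Ξ, ℝ)).Pairwise fun f g => t ≤ dist f g) :
    (s.card : ℝ≥0∞) ≤ packingNum F t :=
  le_iSup₂_of_le s ⟨hs, hp⟩ le_rfl

theorem packingNum_anti {Ξ : Type*} [TopologicalSpace Ξ] [CompactSpace Ξ] (F : Set C(Ξ, ℝ)) :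
    Antitone (packingNum F) := fun _ _ hst =>
  iSup₂_le fun _ h => card_le_packingNum h.1 fun _ hf _ hg hne => hst.trans (h.2 hf hg hne)

theorem packingNum_lt_top {Ξ : Type*} [TopologicalSpace Ξ] [CompactSpace Ξ] {F : Set C(Ξ, ℝ)}
    (hF : IsCompact F) {t : ℝ} (ht : 0 < t) : packingNum F t < ∞ := by
  obtain ⟨A, hA, hcov⟩ := Metric.totallyBounded_iff.1 hF.totallyBounded (t / 2) (half_pos ht)
  lift A to Finset C(Ξ, ℝ) using hA
  refine lt_of_le_of_lt (iSup₂_le fun s hs => ?_) (ENNReal.natCast_lt_top A.card)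
  have hex : ∀ f ∈ s, ∃ y ∈ A, dist f y < t / 2 := fun f hf => by
    simpa using hcov (hs.1 hf)
  choose! g hgA hg using hex
  refine Nat.cast_le.2 (Finset.card_le_card_of_injOn g hgA fun f hf f' hf' h => ?_)
  by_contra hne
  have h1 := hs.2 hf hf' hne
  have h2 := dist_triangle_right f f' (g f)
  have h3 := hg f hf
  have h4 := hg f' hf'
  rw [← h] at h4
  linarith

theorem one_le_packingNum {Ξ : Type*} [TopologicalSpace Ξ] [CompactSpace Ξ] {F : Set C(Ξ, ℝ)}
    (hF : F.Nonempty) (t : ℝ) : 1 ≤ packingNum F t := by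
  obtain ⟨f, hf⟩ := hF
  have := card_le_packingNum (F := F) (t := t) (s := {f}) (by simpa using hf) (by simp)
  simpa using this

/-- A maximal packing is a net. -/
theorem exists_net_card_le_packingNum {Ξ : Type*} [TopologicalSpace Ξ] [CompactSpace Ξ]
    {F : Set C(Ξ, ℝ)} (hF : IsCompact F) {t : ℝ} (ht : 0 < t) :
    ∃ A : Finset F, (∀ f : F, ∃ y ∈ A, dist f y ≤ t) ∧
      (A.card : ℝ) ≤ (packingNum F t).toReal := by
  classical
  have hfin := (packingNum_lt_top hF ht).ne
  let S : Set ℕ := {k | ∃ A : Finset F, (A : Set F).Pairwise (fun f g => t ≤ dist f g) ∧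
    A.card = k}
  have hcard : ∀ A : Finset F, (A : Set F).Pairwise (fun f g => t ≤ dist f g) →
      (A.card : ℝ) ≤ (packingNum F t).toReal := by
    intro A hA
    have h := card_le_packingNum (F := F) (t := t) (s := A.map (Function.Embedding.subtype _))
      (by simp) (by
        intro f hf g hg hne
        simp only [Finset.coe_map, Function.Embedding.subtype_apply, mem_image,
          Finset.mem_coe] at hf hg
        obtain ⟨f, hf, rfl⟩ := hf
        obtain ⟨g, hg, rfl⟩ := hg
        exact hA hf hg fun h => hne (by rw [h]))
    rw [Finset.card_map] at h
    simpa using ENNReal.toReal_mono hfin h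
  have hbdd : BddAbove S := by
    obtain ⟨N, hN⟩ := exists_nat_ge (packingNum F t).toReal
    refine ⟨N, ?_⟩
    rintro _ ⟨A, hA, rfl⟩
    exact_mod_cast (hcard A hA).trans hN
  obtain ⟨A, hA, hAmax⟩ := Nat.sSup_mem (s := S) ⟨0, ∅, by simp, rfl⟩ hbdd
  refine ⟨A, fun f => ?_, hcard A hA⟩
  by_contra! hf
  have hfA : f ∉ A := fun h => by
    have := hf f h
    rw [dist_self] at this
    linarith
  have hins : (insert f A).card ≤ sSup S := by
    refine le_csSup hbdd ⟨insert f A, ?_, rfl⟩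
    rw [Finset.coe_insert, pairwise_insert]
    exact ⟨hA, fun g hg _ => ⟨(hf g hg).le, (hf g hg).le.trans_eq (dist_comm _ _)⟩⟩
  rw [Finset.card_insert_of_notMem hfA, hAmax] at hins
  omega

theorem exists_net_log_card_le_packingNum {Ξ : Type*} [TopologicalSpace Ξ] [CompactSpace Ξ]
    {F : Set C(Ξ, ℝ)} (hF : IsCompact F) {t : ℝ} (ht : 0 < t) :
    ∃ A : Finset F, (∀ f : F, ∃ y ∈ A, dist f y ≤ t) ∧
      Real.log A.card ≤ Real.sqrt (Real.log (packingNum F t).toReal) ^ 2 := by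
  obtain ⟨A, hA, hcard⟩ := exists_net_card_le_packingNum hF ht
  refine ⟨A, hA, ?_⟩
  rcases A.eq_empty_or_nonempty with rfl | hne
  · simp
  · have h1 : (1 : ℝ) ≤ A.card := by exact_mod_cast hne.card_pos
    rw [Real.sq_sqrt (Real.log_nonneg (h1.trans hcard))]
    exact Real.log_le_log (by linarith) hcard

theorem antitoneOn_sqrt_log_packingNum {Ξ : Type*} [TopologicalSpace Ξ] [CompactSpace Ξ]
    {F : Set C(Ξ, ℝ)} (hF : IsCompact F) (hne : F.Nonempty) :
    AntitoneOn (fun t => Real.sqrt (Real.log (packingNum F t).toReal)) (Ioi 0) := by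
  intro s hs t _ hst
  have hs' := (packingNum_lt_top hF hs).ne
  have ht' := ne_top_of_le_ne_top hs' (packingNum_anti F hst)
  have h1 : 1 ≤ (packingNum F t).toReal := by
    simpa using ENNReal.toReal_mono ht' (one_le_packingNum hne t)
  exact Real.sqrt_le_sqrt (Real.log_le_log (by linarith)
    (ENNReal.toReal_mono hs' (packingNum_anti F hst)))

/-- Nets of an interval `[0, b]`, with a cardinality bound. -/
theorem exists_net_Icc_log_card_le {b ε : ℝ} (hb : 0 ≤ b) (hε : 0 < ε) :
    ∃ A : Finset (Icc (0 : ℝ) b), (∀ x : Icc (0 : ℝ) b, ∃ y ∈ A, dist x y ≤ ε) ∧ A.Nonempty ∧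
      Real.log A.card ≤ (Iic b).indicator (fun t => Real.sqrt b * t ^ (-(1 / 2) : ℝ)) ε ^ 2 := by
  classical
  let p : ℕ → Icc (0 : ℝ) b := fun j => ⟨min (j * ε) b, le_min (by positivity) hb, min_le_right _ _⟩
  refine ⟨(Finset.range (⌊b / ε⌋₊ + 1)).image p, fun x => ?_, ⟨p 0, by
    exact Finset.mem_image_of_mem _ (by simp)⟩, ?_⟩
  · have hx0 : 0 ≤ (x : ℝ) / ε := div_nonneg x.2.1 hε.le
    have h1 := Nat.floor_le hx0
    have h2 := Nat.lt_floor_add_one ((x : ℝ) / ε)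
    rw [le_div_iff₀ hε] at h1
    rw [div_lt_iff₀ hε] at h2
    refine ⟨p ⌊(x : ℝ) / ε⌋₊, Finset.mem_image_of_mem _ ?_, ?_⟩
    · rw [Finset.mem_range, Nat.lt_succ_iff]
      exact Nat.floor_le_floor (div_le_div_of_nonneg_right x.2.2 hε.le)
    · have hp : (p ⌊(x : ℝ) / ε⌋₊ : ℝ) = ⌊(x : ℝ) / ε⌋₊ * ε := min_eq_left (h1.trans x.2.2)
      rw [Subtype.dist_eq, hp, Real.dist_eq, abs_of_nonneg (by linarith)]
      linarith
  · have hcard : ((Finset.range (⌊b / ε⌋₊ + 1)).image p).card ≤ ⌊b / ε⌋₊ + 1 := by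
      simpa using Finset.card_image_le (s := Finset.range (⌊b / ε⌋₊ + 1)) (f := p)
    have hpos : 0 < ((Finset.range (⌊b / ε⌋₊ + 1)).image p).card :=
      Finset.card_pos.2 (by simp)
    have hlog : Real.log ((Finset.range (⌊b / ε⌋₊ + 1)).image p).card ≤ ⌊b / ε⌋₊ := by
      refine (Real.log_le_sub_one_of_pos (by exact_mod_cast hpos)).trans ?_
      have : (((Finset.range (⌊b / ε⌋₊ + 1)).image p).card : ℝ) ≤ ⌊b / ε⌋₊ + 1 := by
        exact_mod_cast hcard
      linarith
    refine hlog.trans ?_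
    by_cases h : ε ≤ b
    · rw [indicator_of_mem (mem_Iic.2 h), mul_pow, Real.sq_sqrt hb, ← Real.rpow_natCast,
        ← Real.rpow_mul hε.le]
      norm_num
      rw [Real.rpow_neg_one, ← div_eq_mul_inv]
      exact Nat.floor_le (by positivity)
    · rw [indicator_of_notMem (by simpa using h), Nat.floor_eq_zero.2
        ((div_lt_one hε).2 (not_le.1 h))]
      simp

theorem antitoneOn_indicator_rpow {b : ℝ} :
    AntitoneOn ((Iic b).indicator fun t => Real.sqrt b * t ^ (-(1 / 2) : ℝ)) (Ioi 0) := by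
  intro s hs t _ hst
  have hs' : 0 < s := hs
  by_cases h : t ≤ b
  · rw [indicator_of_mem (mem_Iic.2 h), indicator_of_mem (mem_Iic.2 (hst.trans h))]
    exact mul_le_mul_of_nonneg_left (Real.rpow_le_rpow_of_nonpos hs' hst (by norm_num))
      (Real.sqrt_nonneg _)
  · rw [indicator_of_notMem (by simpa using h)]
    exact indicator_apply_nonneg fun _ => by positivity

theorem integrableOn_indicator_rpow {b : ℝ} (hb : 0 ≤ b) :
    IntegrableOn ((Iic b).indicator fun t => Real.sqrt b * t ^ (-(1 / 2) : ℝ)) (Ioi 0) := by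
  rw [IntegrableOn, integrable_indicator_iff measurableSet_Iic, IntegrableOn,
    Measure.restrict_restrict measurableSet_Iic, inter_comm, Ioi_inter_Iic]
  have := (intervalIntegral.intervalIntegrable_rpow' (a := 0) (b := b)
    (r := -(1 / 2)) (by norm_num)).const_mul (Real.sqrt b)
  exact (intervalIntegrable_iff_integrableOn_Ioc_of_le hb).1 this

theorem integral_indicator_rpow {b : ℝ} (hb : 0 ≤ b) :
    ∫ t in Ioi 0, (Iic b).indicator (fun t => Real.sqrt b * t ^ (-(1 / 2) : ℝ)) t = 2 * b := by
  rw [integral_indicator measurableSet_Iic, Measure.restrict_restrict measurableSet_Iic,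
    inter_comm, Ioi_inter_Iic, ← intervalIntegral.integral_of_le hb,
    intervalIntegral.integral_const_mul, integral_rpow (Or.inl (by norm_num))]
  rw [Real.zero_rpow (by norm_num), show (-(1 / 2) + 1 : ℝ) = 1 / 2 by norm_num,
    ← Real.sqrt_eq_rpow]
  have := Real.mul_self_sqrt hb
  linarith

theorem norm_le_supNormF {Ξ : Type*} [TopologicalSpace Ξ] [CompactSpace Ξ] {F : Set C(Ξ, ℝ)}
    (hF : IsCompact F) {f : C(Ξ, ℝ)} (hf : f ∈ F) : ‖f‖ ≤ supNormF F := by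
  obtain ⟨C, hC⟩ := hF.isBounded.exists_norm_le
  exact le_ciSup (f := fun f : F => ‖(f : C(Ξ, ℝ))‖)
    ⟨C, by rintro _ ⟨f, rfl⟩; exact hC f f.2⟩ ⟨f, hf⟩

theorem sInf_cost_nonneg {Ξ : Type*} {c : Ξ → Ξ → ℝ} (hc_nonneg : ∀ ξ ζ, 0 ≤ c ξ ζ) (ξ : Ξ)
    (s : Set Ξ) : 0 ≤ sInf (c ξ '' s) :=
  Real.sInf_nonneg (by rintro _ ⟨ζ, -, rfl⟩; exact hc_nonneg ξ ζ)

theorem nonempty_of_rhoCrit_pos {Ξ : Type*} [TopologicalSpace Ξ] [MeasurableSpace Ξ]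
    {c : Ξ → Ξ → ℝ} {P : Measure Ξ} {F : Set C(Ξ, ℝ)} (h : 0 < rhoCrit c P F) : F.Nonempty := by
  by_contra! hF
  subst hF
  simp [rhoCrit] at h

theorem supNormF_pos {Ξ : Type*} [TopologicalSpace Ξ] [CompactSpace Ξ] [MeasurableSpace Ξ]
    {c : Ξ → Ξ → ℝ} (hc_nonneg : ∀ ξ ζ, 0 ≤ c ξ ζ) (hc_self : ∀ ξ, c ξ ξ = 0)
    {P : Measure Ξ} {F : Set C(Ξ, ℝ)} (hF : IsCompact F) (h : 0 < rhoCrit c P F) :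
    0 < supNormF F := by
  obtain ⟨f, hf⟩ := nonempty_of_rhoCrit_pos h
  by_contra! hneg
  have hf0 : f = 0 := norm_le_zero_iff.1 ((norm_le_supNormF hF hf).trans hneg)
  have hle : rhoCrit c P F ≤ ∫ ξ, sInf (c ξ '' argmaxSet f) ∂P :=
    ciInf_le (f := fun f : F => ∫ ξ, sInf (c ξ '' argmaxSet (f : C(Ξ, ℝ))) ∂P)
      ⟨0, by rintro _ ⟨f, rfl⟩; exact integral_nonneg fun ξ => sInf_cost_nonneg hc_nonneg ξ _⟩
      ⟨f, hf⟩
  have hzero : ∀ ξ, sInf (c ξ '' argmaxSet f) = 0 := fun ξ =>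
    le_antisymm (csInf_le ⟨0, by rintro _ ⟨ζ, -, rfl⟩; exact hc_nonneg ξ ζ⟩
      ⟨ξ, by simp [argmaxSet, hf0], hc_self ξ⟩) (sInf_cost_nonneg hc_nonneg ξ _)
  simp only [hzero, integral_zero] at hle
  linarith

theorem mul_rhoMax_le_integral {Ξ : Type*} [MetricSpace Ξ] [CompactSpace Ξ] [Nonempty Ξ]
    [MeasurableSpace Ξ] [BorelSpace Ξ] {c : Ξ → Ξ → ℝ}
    (hc : Continuous fun p : Ξ × Ξ => c p.1 p.2) (hc_nonneg : ∀ ξ ζ, 0 ≤ c ξ ζ)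
    (P : Measure Ξ) [IsFiniteMeasure P] {F : Set C(Ξ, ℝ)} {f : C(Ξ, ℝ)} (hf : f ∈ F) {a b : ℝ}
    (hab : a ≤ b) :
    (b - a) * rhoMax c P F b ≤ ∫ ξ, (dualGen c a f ξ - dualGen c b f ξ) ∂P := by
  have h1 : rhoMax c P F b
      ≤ ∫ ξ, sInf (c ξ '' {ζ | ∀ ζ', f ζ' - b * c ξ ζ' ≤ f ζ - b * c ξ ζ}) ∂P :=
    ciInf_le (f := fun f : F => ∫ ξ, sInf (c ξ '' {ζ | ∀ ζ',
        (f : C(Ξ, ℝ)) ζ' - b * c ξ ζ' ≤ (f : C(Ξ, ℝ)) ζ - b * c ξ ζ}) ∂P)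
      ⟨0, by rintro _ ⟨f, rfl⟩; exact integral_nonneg fun ξ => sInf_cost_nonneg hc_nonneg ξ _⟩
      ⟨f, hf⟩
  refine (mul_le_mul_of_nonneg_left h1 (sub_nonneg.2 hab)).trans ?_
  rw [← integral_const_mul]
  exact integral_mono_of_nonneg
    (Eventually.of_forall fun ξ => mul_nonneg (sub_nonneg.2 hab) (sInf_cost_nonneg hc_nonneg ξ _))
    (integrable_of_continuous ((continuous_dualGen hc a f).sub (continuous_dualGen hc b f)))
    (Eventually.of_forall fun ξ => mul_sInf_le_dualGen_sub hc hc_nonneg hab f ξ)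

section Concentration

variable {Ξ : Type*} [MetricSpace Ξ] [CompactSpace Ξ] [Nonempty Ξ] [MeasurableSpace Ξ]
  [BorelSpace Ξ] {c : Ξ → Ξ → ℝ}

/-- Uniform deviations of the rescaled dual generators, for scales in `[0, b]`. -/
theorem measure_not_forall_empDev_dualGen_smul_le
    (hc : Continuous fun p : Ξ × Ξ => c p.1 p.2) (hc_nonneg : ∀ ξ ζ, 0 ≤ c ξ ζ)
    (hc_self : ∀ ξ, c ξ ξ = 0) {F : Set C(Ξ, ℝ)} (hF : IsCompact F) (hne : F.Nonempty)
    (hdudley : IntegrableOn (fun t => Real.sqrt (Real.log ((packingNum F t).toReal)))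
      (Ioi (0 : ℝ)))
    (hpos : 0 < supNormF F) (P : Measure Ξ) [IsProbabilityMeasure P] {b : ℝ} (hb : 0 < b)
    {n : ℕ} (hn : 0 < n) {δ : ℝ} (hδ : δ ∈ Ioo (0 : ℝ) 1) :
    Measure.pi (fun _ : Fin n => P) {ω | ¬ ∀ t : F × Icc (0 : ℝ) b,
        empDev P (dualGen c 1 ((t.2 : ℝ) • (t.1 : C(Ξ, ℝ)) : C(Ξ, ℝ))) ω ≤
          (48 * (supNormF F + b) * (dudleyEntropy F + 2 * b)
            + 2 * (supNormF F * b) * Real.sqrt (2 * Real.log (2 / δ))) / Real.sqrt n}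
      ≤ ENNReal.ofReal (δ / 2) := by
  classical
  have hw := integrableOn_indicator_rpow hb.le
  have hw0 : ∀ ε : ℝ, 0 < ε →
      0 ≤ (Iic b).indicator (fun t => Real.sqrt b * t ^ (-(1 / 2) : ℝ)) ε := fun ε hε =>
    indicator_apply_nonneg fun _ => by positivity
  have key := measure_not_forall_empDev_le P hn
    (fun t : F × Icc (0 : ℝ) b => dualGen c 1 ((t.2 : ℝ) • (t.1 : C(Ξ, ℝ)) : C(Ξ, ℝ)))
    (fun t => (continuous_dualGen hc _ _).measurable) (B := supNormF F * b) (by positivity)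
    ?_ (L := supNormF F + b) (by positivity) ?_
    (u := fun t => Real.sqrt (Real.log ((packingNum F t).toReal)) +
      (Iic b).indicator (fun t => Real.sqrt b * t ^ (-(1 / 2) : ℝ)) t)
    (fun ε hε => add_nonneg (Real.sqrt_nonneg _) (hw0 ε hε))
    ((antitoneOn_sqrt_log_packingNum hF hne).add antitoneOn_indicator_rpow)
    (hdudley.add hw) ?_ hδ
  · rw [integral_add hdudley hw, integral_indicator_rpow hb.le] at key
    exact key
  · rintro ⟨⟨f, hf⟩, ⟨μ, hμ0, hμb⟩⟩ ξ
    have hle : ‖μ • f‖ ≤ supNormF F * b := by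
      rw [norm_smul, Real.norm_of_nonneg hμ0, mul_comm]
      exact mul_le_mul (norm_le_supNormF hF hf) hμb hμ0 hpos.le
    exact abs_le.2 ⟨(neg_le_neg hle).trans (neg_norm_le_dualGen hc hc_self 1 (μ • f) ξ),
      (dualGen_le_norm hc hc_nonneg zero_le_one (μ • f) ξ).trans hle⟩
  · rintro ⟨⟨f, hf⟩, ⟨μ, hμ0, hμb⟩⟩ ⟨⟨g, hg⟩, ⟨ν, hν0, hνb⟩⟩ ξ
    refine (abs_dualGen_sub_le hc 1 (μ • f) (ν • g) ξ).trans ?_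
    have h1 : dist f g ≤ dist ((⟨f, hf⟩, ⟨μ, hμ0, hμb⟩) : F × Icc (0 : ℝ) b)
        (⟨g, hg⟩, ⟨ν, hν0, hνb⟩) := le_max_left _ _
    have h2 : dist μ ν ≤ dist ((⟨f, hf⟩, ⟨μ, hμ0, hμb⟩) : F × Icc (0 : ℝ) b)
        (⟨g, hg⟩, ⟨ν, hν0, hνb⟩) := le_max_right _ _
    have h3 : μ • f - ν • g = (μ - ν) • f + ν • (f - g) := by
      rw [sub_smul, smul_sub]
      abel
    calc ‖μ • f - ν • g‖ ≤ ‖(μ - ν) • f‖ + ‖ν • (f - g)‖ := by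
          rw [h3]
          exact norm_add_le _ _
      _ = ‖f‖ * dist μ ν + ν * dist f g := by
          rw [norm_smul, norm_smul, Real.norm_of_nonneg hν0, Real.dist_eq, Real.norm_eq_abs,
            dist_eq_norm, mul_comm]
      _ ≤ _ := by
          rw [add_mul]
          exact add_le_add (mul_le_mul (norm_le_supNormF hF hf) h2 dist_nonneg hpos.le)
            (mul_le_mul hνb h1 dist_nonneg hb.le)
  · intro ε hε
    obtain ⟨A, hA, hAcard⟩ := exists_net_log_card_le_packingNum hF hε
    obtain ⟨A', hA', hne', hA'card⟩ := exists_net_Icc_log_card_le hb.le hε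
    refine ⟨A ×ˢ A', fun t => ?_, ?_⟩
    · obtain ⟨y, hy, hy'⟩ := hA t.1
      obtain ⟨z, hz, hz'⟩ := hA' t.2
      exact ⟨(y, z), Finset.mk_mem_product hy hz, max_le hy' hz'⟩
    · obtain ⟨f, hf⟩ := hne
      obtain ⟨y, hy, -⟩ := hA ⟨f, hf⟩
      have hAne : (A.card : ℝ) ≠ 0 := by exact_mod_cast (Finset.card_pos.2 ⟨y, hy⟩).ne'
      have hA'ne : (A'.card : ℝ) ≠ 0 := by exact_mod_cast hne'.card_pos.ne'
      rw [Finset.card_product, Nat.cast_mul, Real.log_mul hAne hA'ne]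
      have := mul_nonneg (Real.sqrt_nonneg (Real.log ((packingNum F ε).toReal))) (hw0 ε hε)
      nlinarith

/-- Uniform deviations of differences of dual generators for two multipliers. -/
theorem measure_not_forall_empDev_dualGen_sub_le
    (hc : Continuous fun p : Ξ × Ξ => c p.1 p.2) (hc_nonneg : ∀ ξ ζ, 0 ≤ c ξ ζ)
    (hc_self : ∀ ξ, c ξ ξ = 0) {F : Set C(Ξ, ℝ)} (hF : IsCompact F) (hne : F.Nonempty)
    (hdudley : IntegrableOn (fun t => Real.sqrt (Real.log ((packingNum F t).toReal)))
      (Ioi (0 : ℝ)))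
    (hpos : 0 < supNormF F) (P : Measure Ξ) [IsProbabilityMeasure P] {a b : ℝ} (ha : 0 ≤ a)
    (hb : 0 ≤ b) {n : ℕ} (hn : 0 < n) {δ : ℝ} (hδ : δ ∈ Ioo (0 : ℝ) 1) :
    Measure.pi (fun _ : Fin n => P) {ω | ¬ ∀ f : F,
        empDev P (fun ξ => dualGen c a (f : C(Ξ, ℝ)) ξ - dualGen c b (f : C(Ξ, ℝ)) ξ) ω ≤
          (96 * dudleyEntropy F + 4 * supNormF F * Real.sqrt (2 * Real.log (2 / δ)))
            / Real.sqrt n}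
      ≤ ENNReal.ofReal (δ / 2) := by
  have key := measure_not_forall_empDev_le P hn
    (fun (f : F) ξ => dualGen c a (f : C(Ξ, ℝ)) ξ - dualGen c b (f : C(Ξ, ℝ)) ξ)
    (fun f => ((continuous_dualGen hc a f).sub (continuous_dualGen hc b f)).measurable)
    (B := 2 * supNormF F) (by positivity) ?_ (L := 2) (by positivity) ?_
    (fun ε _ => Real.sqrt_nonneg _) (antitoneOn_sqrt_log_packingNum hF hne) hdudley
    (fun ε hε => exists_net_log_card_le_packingNum hF hε) hδ
  · convert key using 8
    rw [dudleyEntropy]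
    ring
  · rintro ⟨f, hf⟩ ξ
    have h := norm_le_supNormF hF hf
    have h1 := neg_norm_le_dualGen hc hc_self a f ξ
    have h2 := neg_norm_le_dualGen hc hc_self b f ξ
    have h3 := dualGen_le_norm hc hc_nonneg ha f ξ
    have h4 := dualGen_le_norm hc hc_nonneg hb f ξ
    exact abs_le.2 ⟨by linarith, by linarith⟩
  · rintro ⟨f, hf⟩ ⟨g, hg⟩ ξ
    have h1 := abs_le.1 (abs_dualGen_sub_le hc a f g ξ)
    have h2 := abs_le.1 (abs_dualGen_sub_le hc b f g ξ)
    rw [Subtype.dist_eq, dist_eq_norm]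
    exact abs_le.2 ⟨by dsimp only; linarith [h1.1, h2.2], by dsimp only; linarith [h1.2, h2.1]⟩

/-- On the event where the deviations are controlled, the empirical robust risk dominates the
population robust risk with a reduced radius. -/
theorem robustRisk_le_robustRisk_empiricalMeasure
    (hc : Continuous fun p : Ξ × Ξ => c p.1 p.2) (hc_nonneg : ∀ ξ ζ, 0 ≤ c ξ ζ)
    (hc_self : ∀ ξ, c ξ ξ = 0) (P : Measure Ξ) [IsProbabilityMeasure P] (f : C(Ξ, ℝ))
    {lam₀ ρ ε : ℝ} (hlam₀ : 0 < lam₀) (hε : 0 ≤ ε) (hρ : ε < ρ) {n : ℕ} (hn : 0 < n)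
    (ω : Fin n → Ξ)
    (hdev : ∀ μ ∈ Icc 0 (1 / lam₀), empDev P (dualGen c 1 (μ • f : C(Ξ, ℝ))) ω ≤ ε)
    (hslope : lam₀ * ρ ≤
      (∑ i, (dualGen c lam₀ f (ω i) - dualGen c (2 * lam₀) f (ω i))) / n) :
    robustRisk c (ρ - ε) P f ≤ robustRisk c ρ (empiricalMeasure n ω) f := by
  have hn' : (0 : ℝ) < n := by exact_mod_cast hn
  have hlarge : ∀ lam, lam₀ ≤ lam →
      robustRisk c (ρ - ε) P f ≤ lam * ρ + (∑ i, dualGen c lam f (ω i)) / n := by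
    intro lam hlam
    have hlam_pos := hlam₀.trans_le hlam
    have hscale : ∀ ξ, dualGen c 1 ((1 / lam) • f : C(Ξ, ℝ)) ξ = 1 / lam * dualGen c lam f ξ := by
      intro ξ
      rw [← dualGen_smul (one_div_nonneg.2 hlam_pos.le), one_div_mul_cancel hlam_pos.ne']
    have h1 := hdev (1 / lam) ⟨by positivity, one_div_le_one_div_of_le hlam₀ hlam⟩
    unfold empDev at h1
    simp_rw [hscale, ← Finset.mul_sum] at h1
    rw [integral_const_mul, mul_div_assoc, ← mul_sub, one_div, inv_mul_le_iff₀ hlam_pos] at h1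
    have h2 := robustRisk_le_dual hc hc_nonneg hc_self P (sub_nonneg.2 hρ.le) f hlam_pos.le
    linarith
  refine le_robustRisk_empiricalMeasure hc hc_nonneg hc_self f hn ω (hε.trans_lt hρ)
    fun lam hlam => ?_
  rcases le_total lam₀ lam with h | h
  · exact hlarge lam h
  · refine (hlarge lam₀ le_rfl).trans ?_
    have h1 : (lam₀ - lam) * ((∑ i, (dualGen c lam₀ f (ω i) - dualGen c (2 * lam₀) f (ω i))) / n)
        ≤ lam₀ * ((∑ i, (dualGen c lam f (ω i) - dualGen c lam₀ f (ω i))) / n) := by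
      rw [← mul_div_assoc, ← mul_div_assoc, Finset.mul_sum, Finset.mul_sum]
      refine div_le_div_of_nonneg_right (Finset.sum_le_sum fun i _ => ?_) hn'.le
      have := mul_dualGen_sub_le hc h (by linarith : lam₀ ≤ 2 * lam₀) f (ω i)
      linarith
    have h2 := (mul_le_mul_of_nonneg_left hslope (sub_nonneg.2 h)).trans h1
    have h3 : (lam₀ - lam) * ρ
        ≤ (∑ i, (dualGen c lam f (ω i) - dualGen c lam₀ f (ω i))) / n := by
      refine le_of_mul_le_mul_left ?_ hlam₀
      linarith
    rw [Finset.sum_sub_distrib, sub_div] at h3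
    linarith

end Concentration

/-- The transport cost from the zero measure is an infimum over the empty set. -/
theorem transportCost_zero_left {Ξ : Type*} [MeasurableSpace Ξ] (c : Ξ → Ξ → ℝ) (Q : Measure Ξ) :
    transportCost c 0 Q = 0 := by
  have h : { r | ∃ π : Measure (Ξ × Ξ), IsProbabilityMeasure π ∧
      π.map Prod.fst = 0 ∧ π.map Prod.snd = Q ∧ r = ∫ p, c p.1 p.2 ∂π } = ∅ := by
    refine eq_empty_of_forall_notMem ?_
    rintro _ ⟨π, hπ, h1, -, -⟩
    rw [Measure.map_eq_zero_iff measurable_fst.aemeasurable] at h1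
    exact IsProbabilityMeasure.ne_zero π h1
  rw [transportCost, h, Real.sInf_empty]

/-- **Generalization guarantee, extended version** (Theorem B.2): with high probability
`R̂_ρ(f) ≥ R_{ρ-α/√n}(f) ≥ E_P[f]` simultaneously for all `f ∈ F`. -/
theorem generalization_wdro_extended
    {Ξ : Type*} [MetricSpace Ξ] [CompactSpace Ξ] [Nonempty Ξ]
    [MeasurableSpace Ξ] [BorelSpace Ξ]
    (c : Ξ → Ξ → ℝ)
    (hc_cont : Continuous fun p : Ξ × Ξ => c p.1 p.2)
    (hc_nonneg : ∀ ξ ζ, 0 ≤ c ξ ζ)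
    (hc_zero : ∀ ξ ζ, c ξ ζ = 0 ↔ ξ = ζ)
    (F : Set C(Ξ, ℝ)) (hFcomp : IsCompact F)
    (hdudley : IntegrableOn (fun t => Real.sqrt (Real.log ((packingNum F t).toReal)))
      (Ioi (0 : ℝ)))
    (P : Measure Ξ) [IsProbabilityMeasure P]
    (hcrit : 0 < rhoCrit c P F)
    (lamLow : ℝ) (hlamLow : 0 < lamLow)
    (hlow : ∀ lam ∈ Icc (0 : ℝ) (2 * lamLow), rhoCrit c P F / 4 ≤ rhoMax c P F lam)
    (δ : ℝ) (hδ : δ ∈ Ioo (0 : ℝ) 1) (n : ℕ) (ρ α β : ℝ)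
    (hα : α = 48 * (supNormF F + 1 / lamLow) * (dudleyEntropy F + 2 / lamLow)
        + (2 * supNormF F / lamLow) * Real.sqrt (2 * Real.log (2 / δ)))
    (hβ : β = 96 * dudleyEntropy F / lamLow
        + (4 * supNormF F / lamLow) * Real.sqrt (2 * Real.log (4 / δ)))
    (hρ₁ : α / Real.sqrt n < ρ) (hρ₂ : ρ ≤ rhoCrit c P F / 4 - β / Real.sqrt n) :
    ENNReal.ofReal (1 - δ) ≤
      Measure.pi (fun _ : Fin n => P)
        {ω | ∀ f ∈ F,
          robustRisk c (ρ - α / Real.sqrt n) P ⇑f ≤ robustRisk c ρ (empiricalMeasure n ω) ⇑f ∧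
          ∫ ξ, f ξ ∂P ≤ robustRisk c (ρ - α / Real.sqrt n) P ⇑f} := by
  have hc_self : ∀ ξ, c ξ ξ = 0 := fun ξ => (hc_zero ξ ξ).2 rfl
  have hne := nonempty_of_rhoCrit_pos hcrit
  have hpos := supNormF_pos hc_nonneg hc_self hFcomp hcrit
  have hI : 0 ≤ dudleyEntropy F := integral_nonneg fun _ => Real.sqrt_nonneg _
  have hα0 : 0 ≤ α := by
    rw [hα]
    positivity
  have hε : 0 ≤ α / Real.sqrt n := div_nonneg hα0 (Real.sqrt_nonneg _)
  have hself : ∀ f : C(Ξ, ℝ), ∫ ξ, f ξ ∂P ≤ robustRisk c (ρ - α / Real.sqrt n) P f := fun f =>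
    integral_le_robustRisk_self hc_cont hc_nonneg hc_self P (sub_nonneg.2 hρ₁.le) f
  set E := {ω : Fin n → Ξ | ∀ f ∈ F,
    robustRisk c (ρ - α / Real.sqrt n) P ⇑f ≤ robustRisk c ρ (empiricalMeasure n ω) ⇑f ∧
    ∫ ξ, f ξ ∂P ≤ robustRisk c (ρ - α / Real.sqrt n) P ⇑f} with hE
  suffices hcompl : Measure.pi (fun _ : Fin n => P) Eᶜ ≤ ENNReal.ofReal δ by
    have h1 : (1 : ℝ≥0∞) ≤ Measure.pi (fun _ : Fin n => P) E + ENNReal.ofReal δ := by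
      rw [← measure_univ (μ := Measure.pi fun _ : Fin n => P), ← union_compl_self E]
      exact (measure_union_le _ _).trans (by gcongr)
    rw [ENNReal.ofReal_sub _ hδ.1.le, ENNReal.ofReal_one]
    exact tsub_le_iff_right.2 h1
  rcases n.eq_zero_or_pos with rfl | hn
  · have : E = univ := by
      refine eq_univ_of_forall fun ω f _ => ⟨?_, hself f⟩
      refine csSup_le ⟨_, P, inferInstance,
        (transportCost_self_le hc_cont hc_nonneg hc_self P).trans (sub_nonneg.2 hρ₁.le), rfl⟩ ?_
      rintro _ ⟨Q, hQ, -, rfl⟩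
      refine integral_le_robustRisk ?_ f
      have hzero : empiricalMeasure 0 ω = 0 := by simp [empiricalMeasure]
      rw [hzero, transportCost_zero_left]
      exact hε.trans hρ₁.le
    simp [this]
  have hsqrt : 0 < Real.sqrt n := Real.sqrt_pos.2 (by exact_mod_cast hn)
  have hn' : (0 : ℝ) < n := by exact_mod_cast hn
  have hdev := measure_not_forall_empDev_dualGen_smul_le hc_cont hc_nonneg hc_self hFcomp hne
    hdudley hpos P (one_div_pos.2 hlamLow) hn hδ
  have hslope := measure_not_forall_empDev_dualGen_sub_le hc_cont hc_nonneg hc_self hFcomp hne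
    hdudley hpos P hlamLow.le (by positivity : 0 ≤ 2 * lamLow) hn hδ
  have hαeq : (48 * (supNormF F + 1 / lamLow) * (dudleyEntropy F + 2 * (1 / lamLow))
      + 2 * (supNormF F * (1 / lamLow)) * Real.sqrt (2 * Real.log (2 / δ))) = α := by
    rw [hα]
    ring
  have hβle : 96 * dudleyEntropy F + 4 * supNormF F * Real.sqrt (2 * Real.log (2 / δ))
      ≤ lamLow * β := by
    have h1 : lamLow * β
        = 96 * dudleyEntropy F + 4 * supNormF F * Real.sqrt (2 * Real.log (4 / δ)) := by
      rw [hβ]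
      field_simp
    have h2 : Real.log (2 / δ) ≤ Real.log (4 / δ) :=
      Real.log_le_log (div_pos two_pos hδ.1) (div_le_div_of_nonneg_right (by norm_num) hδ.1.le)
    rw [h1]
    gcongr
  rw [hαeq] at hdev
  rw [← add_halves δ, ENNReal.ofReal_add (half_pos hδ.1).le (half_pos hδ.1).le]
  refine (measure_mono ?_).trans ((measure_union_le _ _).trans (add_le_add hdev hslope))
  rw [compl_subset_comm]
  intro ω hω f hf
  simp only [compl_union, mem_inter_iff, mem_compl_iff, mem_ofPred_eq, not_not] at hω
  obtain ⟨hω₁, hω₂⟩ := hω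
  refine ⟨robustRisk_le_robustRisk_empiricalMeasure hc_cont hc_nonneg hc_self P f hlamLow hε hρ₁
    hn ω (fun μ hμ => hω₁ (⟨f, hf⟩, ⟨μ, hμ⟩)) ?_, hself f⟩
  have h1 := hω₂ ⟨f, hf⟩
  unfold empDev at h1
  have h2 := mul_rhoMax_le_integral hc_cont hc_nonneg P hf (by linarith : lamLow ≤ 2 * lamLow)
  have h3 := mul_le_mul_of_nonneg_left (hlow (2 * lamLow) ⟨by positivity, le_rfl⟩) hlamLow.le
  have h4 := div_le_div_of_nonneg_right hβle hsqrt.le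
  have h5 := mul_le_mul_of_nonneg_left hρ₂ hlamLow.le
  rw [mul_div_assoc] at h4
  linarith
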